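/- arXiv:1001.2872 — 12 statements merged into one kernel-verified Lean document; each statement's English description precedes it below -/
import Mathlib

section
/- Let K be a field of characteristic greater than 3, and let a ∈ K with a² ≠ 4. For all x, y ∈ K satisfying y² = x⁴ + a·x² + 1, if u = (x² − y + 1)/2 and v = x·(2x² − 2y + a)/4, then v² = u·(u − 1)·(u − (2 − a)/4). -/
/-- Forward direction of the birational equivalence between the Jacobi quartic
curve `E_a : y² = x⁴ + a x² + 1` and the Weierstrass curve
`W_a : v² = u (u − 1)(u − (2 − a)/4)`. -/
theorem jacobi_quartic_to_weierstrass {K : Type*} [Field K]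
    (hchar : 3 < ringChar K) (a : K) (ha : a ^ 2 ≠ 4)
    (x y : K) (hxy : y ^ 2 = x ^ 4 + a * x ^ 2 + 1)
    (u v : K) (hu : u = (x ^ 2 - y + 1) / 2)
    (hv : v = x * (2 * x ^ 2 - 2 * y + a) / 4) :
    v ^ 2 = u * (u - 1) * (u - (2 - a) / 4) := by
  have h2 : (2 : K) ≠ 0 := Ring.two_ne_zero (by omega)
  have h4 : (4 : K) ≠ 0 := by
    have h : (4 : K) = 2 * 2 := by norm_num
    rw [h]
    exact mul_ne_zero h2 h2
  have hu' : 2 * u = x ^ 2 - y + 1 := by rw [hu]; field_simp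
  have hv' : 4 * v = x * (2 * x ^ 2 - 2 * y + a) := by rw [hv]; field_simp
  have hw : 4 * (u - (2 - a) / 4) = 2 * (x ^ 2 - y) + a := by
    have h : 4 * ((2 - a) / 4) = 2 - a := by field_simp
    linear_combination 2 * hu' - h
  have h16 : (4 * 4 : K) ≠ 0 := mul_ne_zero h4 h4
  apply mul_left_cancel₀ h16
  have e1 : 4 * 4 * v ^ 2 = (x * (2 * x ^ 2 - 2 * y + a)) ^ 2 := by
    rw [← hv']; ring
  have e2 : 4 * 4 * (u * (u - 1) * (u - (2 - a) / 4))
      = (x ^ 2 - y + 1) * ((x ^ 2 - y + 1) - 2) * (2 * (x ^ 2 - y) + a) := by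
    rw [← hu', ← hw]; ring
  rw [e1, e2]
  linear_combination -(2 * (x ^ 2 - y) + a) * hxy
end

section
/- Let K be a field of characteristic greater than 3, and let a ∈ K with a² ≠ 4. For all u, v ∈ K satisfying v² = u·(u − 1)·(u − (2 − a)/4) and 4u + a − 2 ≠ 0, if x = 4v/(4u + a − 2) and y = (4v/(4u + a − 2))² − 2u + 1, then y² = x⁴ + a·x² + 1. -/
/-- Inverse direction of the birational equivalence between the Jacobi quartic
curve `E_a : y² = x⁴ + a x² + 1` and the Weierstrass curve
`W_a : v² = u (u − 1)(u − (2 − a)/4)`. -/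
theorem weierstrass_to_jacobi_quartic {K : Type*} [Field K]
    (hchar : 3 < ringChar K) (a : K) (ha : a ^ 2 ≠ 4)
    (u v : K) (huv : v ^ 2 = u * (u - 1) * (u - (2 - a) / 4))
    (hden : 4 * u + a - 2 ≠ 0)
    (x y : K) (hx : x = 4 * v / (4 * u + a - 2))
    (hy : y = (4 * v / (4 * u + a - 2)) ^ 2 - 2 * u + 1) :
    y ^ 2 = x ^ 4 + a * x ^ 2 + 1 := by
  have h2 : (2 : K) ≠ 0 := Ring.two_ne_zero (by omega)
  have h4 : (4 : K) ≠ 0 := by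
    have h := mul_ne_zero h2 h2
    norm_num at h
    exact h
  have hv : 4 * v ^ 2 = u * (u - 1) * (4 * u + a - 2) := by
    rw [huv]
    field_simp
    ring
  have hxD : x * (4 * u + a - 2) = 4 * v := by
    rw [hx]
    exact div_mul_cancel₀ _ hden
  have key : x ^ 2 * (4 * u + a - 2) = 4 * u * (u - 1) := by
    apply mul_right_cancel₀ hden
    linear_combination (x * (4 * u + a - 2) + 4 * v) * hxD + 4 * hv
  rw [← hx] at hy
  rw [hy]
  linear_combination -key
end

section
/- Let K be a field of characteristic greater than 3, and let a, b ∈ K with a² ≠ 4 and b² ≠ 4. Then 16·(a² + 12)³/(a² − 4)² = 16·(b² + 12)³/(b² − 4)² if and only if (2 − b)/4 belongs to the set {(2 − a)/4, 4/(2 − a), (2 + a)/4, 4/(2 + a), (a − 2)/(a + 2), (a + 2)/(a − 2)}. -/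
/-- Two Jacobi quartic curves `E_a` and `E_b` have the same j-invariant iff
`(2 − b)/4` lies in the orbit `{(2−a)/4, 4/(2−a), (2+a)/4, 4/(2+a),
(a−2)/(a+2), (a+2)/(a−2)}`. -/
theorem jacobi_quartic_j_eq_iff {K : Type*} [Field K]
    (hchar : 3 < ringChar K) (a b : K) (ha : a ^ 2 ≠ 4) (hb : b ^ 2 ≠ 4) :
    16 * (a ^ 2 + 12) ^ 3 / (a ^ 2 - 4) ^ 2 =
      16 * (b ^ 2 + 12) ^ 3 / (b ^ 2 - 4) ^ 2 ↔
    (2 - b) / 4 ∈ ({(2 - a) / 4, 4 / (2 - a), (2 + a) / 4, 4 / (2 + a),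
      (a - 2) / (a + 2), (a + 2) / (a - 2)} : Set K) := by
  have h2 : (2 : K) ≠ 0 := Ring.two_ne_zero (by omega)
  have h4 : (4 : K) ≠ 0 := by
    have : (4 : K) = 2 ^ 2 := by norm_num
    rw [this]; exact pow_ne_zero _ h2
  have h16 : (16 : K) ≠ 0 := by
    have : (16 : K) = 2 ^ 4 := by norm_num
    rw [this]; exact pow_ne_zero _ h2
  have hA : (a ^ 2 - 4) ^ 2 ≠ 0 := pow_ne_zero _ (sub_ne_zero.mpr ha)
  have hB : (b ^ 2 - 4) ^ 2 ≠ 0 := pow_ne_zero _ (sub_ne_zero.mpr hb)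
  have e1 : 2 - a ≠ 0 := fun h => ha (by linear_combination (-a - 2) * h)
  have e2 : 2 + a ≠ 0 := fun h => ha (by linear_combination (a - 2) * h)
  have e3 : a + 2 ≠ 0 := fun h => ha (by linear_combination (a - 2) * h)
  have e4 : a - 2 ≠ 0 := fun h => ha (by linear_combination (a + 2) * h)
  simp only [Set.mem_insert_iff, Set.mem_singleton_iff]
  rw [div_eq_div_iff hA hB, div_eq_div_iff h4 h4, div_eq_div_iff h4 e1, div_eq_div_iff h4 h4,
    div_eq_div_iff h4 e2, div_eq_div_iff h4 e3, div_eq_div_iff h4 e4, mul_left_inj' h4,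
    mul_left_inj' h4]
  simp only [← sub_eq_zero (b := _ * _), ← sub_eq_zero (b := 2 - a), ← sub_eq_zero (b := 2 + a)]
  rw [← or_assoc, ← or_assoc, ← or_assoc, ← or_assoc, ← mul_eq_zero, ← mul_eq_zero,
    ← mul_eq_zero, ← mul_eq_zero, ← mul_eq_zero]
  constructor
  · intro h; apply mul_left_cancel₀ h16; linear_combination h
  · intro h; linear_combination 16 * h
end

section
/- Let F_q be a finite field with q elements of characteristic greater than 3, and let N_a denote the number of distinct values of 16·(a² + 12)³/(a² − 4)² as a ranges over all elements of F_q with a² ≠ 4. Then N_a = (q + 5)/6 if q ≡ 1 or 7 (mod 12), and N_a = (q + 1)/6 if q ≡ 5 or 11 (mod 12). -/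
namespace JQ

variable {F : Type*} [Field F]

/-- The Legendre j-function. -/
def J (x : F) : F := 256 * (x ^ 2 - x + 1) ^ 3 / (x ^ 2 * (x - 1) ^ 2)

lemma J_eq_iff (h2 : (2 : F) ≠ 0) {x y : F} (hx : x ≠ 0) (hx1 : x ≠ 1) (hy : y ≠ 0) (hy1 : y ≠ 1) :
    J y = J x ↔ y = x ∨ y = 1 - x ∨ y = 1 / x ∨ y = 1 / (1 - x) ∨ y = x / (x - 1) ∨
      y = (x - 1) / x := by
  have a1 : x - 1 ≠ 0 := sub_ne_zero.2 hx1
  have a2 : 1 - x ≠ 0 := sub_ne_zero.2 hx1.symm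
  have a3 : y - 1 ≠ 0 := sub_ne_zero.2 hy1
  have h256 : (256 : F) ≠ 0 := by
    have : (256 : F) = 2 ^ 8 := by norm_num
    rw [this]; exact pow_ne_zero _ h2
  have key : J y = J x ↔ (y - x) * ((y - (1 - x)) * ((y * x - 1) * ((y * (1 - x) - 1) *
      ((y * (x - 1) - x) * (y * x - (x - 1)))))) = 0 := by
    unfold J
    rw [div_eq_div_iff (by positivity) (by positivity)]
    constructor
    · intro h
      apply mul_left_cancel₀ h256
      linear_combination -h
    · intro h
      linear_combination (-256) * h
  rw [key]
  simp only [mul_eq_zero]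
  rw [eq_div_iff hx, eq_div_iff a2, eq_div_iff a1, eq_div_iff hx]
  simp only [sub_eq_zero]

lemma J_eq_zero (h2 : (2 : F) ≠ 0) {x : F} (hx : x ≠ 0) (hx1 : x ≠ 1) :
    J x = 0 ↔ x ^ 2 - x + 1 = 0 := by
  have a1 : x - 1 ≠ 0 := sub_ne_zero.2 hx1
  have h256 : (256 : F) ≠ 0 := by
    have : (256 : F) = 2 ^ 8 := by norm_num
    rw [this]; exact pow_ne_zero _ h2
  simp [J, hx, a1, h256]

lemma J_eq_1728 (h2 : (2 : F) ≠ 0) {x : F} (hx : x ≠ 0) (hx1 : x ≠ 1) :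
    J x = 1728 ↔ x = -1 ∨ x = 2 ∨ x = 1 / 2 := by
  have a1 : x - 1 ≠ 0 := sub_ne_zero.2 hx1
  have h64 : (64 : F) ≠ 0 := by
    have : (64 : F) = 2 ^ 6 := by norm_num
    rw [this]; exact pow_ne_zero _ h2
  have key : J x = 1728 ↔ ((x + 1) * ((x - 2) * (x * 2 - 1))) ^ 2 = 0 := by
    unfold J
    rw [div_eq_iff (by positivity)]
    constructor
    · intro h
      apply mul_left_cancel₀ h64
      linear_combination h
    · intro h
      linear_combination 64 * h
  rw [key, eq_div_iff h2]
  simp only [pow_eq_zero_iff two_ne_zero, mul_eq_zero, sub_eq_zero, eq_neg_iff_add_eq_zero]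

variable [Fintype F] [DecidableEq F]

/-- The Legendre parameters. -/
def S (F : Type*) [Field F] [Fintype F] [DecidableEq F] : Finset F :=
  Finset.univ.filter fun x => x ≠ 0 ∧ x ≠ 1

lemma mem_S {x : F} : x ∈ S F ↔ x ≠ 0 ∧ x ≠ 1 := by simp [S]

lemma card_S : (S F).card + 2 = Fintype.card F := by
  have : S F = Finset.univ \ {0, 1} := by ext; simp [S]
  rw [this, Finset.card_sdiff_of_subset (Finset.subset_univ _), Finset.card_pair zero_ne_one,
    Finset.card_univ]
  have : ({0, 1} : Finset F).card ≤ Fintype.card F := Finset.card_le_univ _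
  rw [Finset.card_pair zero_ne_one] at this
  omega

lemma fib_generic (h2 : (2 : F) ≠ 0) {x : F} (hx : x ∈ S F) (j0 : J x ≠ 0)
    (j1 : J x ≠ 1728) : ((S F).filter fun y => J y = J x).card = 6 := by
  obtain ⟨hx, hx1⟩ := mem_S.1 hx
  have a1 : x - 1 ≠ 0 := sub_ne_zero.2 hx1
  have a2 : 1 - x ≠ 0 := sub_ne_zero.2 hx1.symm
  rw [Ne, J_eq_zero h2 hx hx1] at j0
  rw [Ne, J_eq_1728 h2 hx hx1, eq_div_iff h2] at j1
  push Not at j1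
  obtain ⟨b1, b2, b3⟩ := j1
  have : (S F).filter (fun y => J y = J x) =
      {x, 1 - x, 1 / x, 1 / (1 - x), x / (x - 1), (x - 1) / x} := by
    ext y
    simp only [Finset.mem_filter, mem_S, Finset.mem_insert, Finset.mem_singleton]
    constructor
    · rintro ⟨⟨c, d⟩, h⟩
      exact (J_eq_iff h2 hx hx1 c d).1 h
    · intro h
      have hy : y ≠ 0 ∧ y ≠ 1 := by
        rcases h with rfl | rfl | rfl | rfl | rfl | rfl
        · exact ⟨hx, hx1⟩
        all_goals constructor <;> grind
      exact ⟨hy, (J_eq_iff h2 hx hx1 hy.1 hy.2).2 h⟩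
  rw [this]
  rw [Finset.card_insert_of_notMem, Finset.card_insert_of_notMem, Finset.card_insert_of_notMem,
    Finset.card_insert_of_notMem, Finset.card_insert_of_notMem, Finset.card_singleton]
  all_goals
    simp only [Finset.mem_insert, Finset.mem_singleton, not_or]
    grind

lemma fib_1728 (h2 : (2 : F) ≠ 0) (h3 : (3 : F) ≠ 0) :
    ((S F).filter fun y => J y = 1728).card = 3 := by
  have : (S F).filter (fun y => J y = 1728) = {-1, 2, 1 / 2} := by
    ext y
    simp only [Finset.mem_filter, mem_S, Finset.mem_insert, Finset.mem_singleton]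
    constructor
    · rintro ⟨⟨c, d⟩, h⟩
      exact (J_eq_1728 h2 c d).1 h
    · intro h
      have hy : y ≠ 0 ∧ y ≠ 1 := by
        rcases h with rfl | rfl | rfl
        all_goals constructor <;> grind
      exact ⟨hy, (J_eq_1728 h2 hy.1 hy.2).2 h⟩
  rw [this]
  rw [Finset.card_insert_of_notMem, Finset.card_insert_of_notMem, Finset.card_singleton]
  all_goals
    simp only [Finset.mem_insert, Finset.mem_singleton, not_or]
    grind

lemma fib_zero (h2 : (2 : F) ≠ 0) (h3 : (3 : F) ≠ 0) {x : F} (hx : x ∈ S F) (j0 : J x = 0) :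
    ((S F).filter fun y => J y = 0).card = 2 := by
  obtain ⟨hx, hx1⟩ := mem_S.1 hx
  rw [J_eq_zero h2 hx hx1] at j0
  have : (S F).filter (fun y => J y = 0) = {x, 1 - x} := by
    ext y
    simp only [Finset.mem_filter, mem_S, Finset.mem_insert, Finset.mem_singleton]
    constructor
    · rintro ⟨⟨c, d⟩, h⟩
      rw [J_eq_zero h2 c d] at h
      have : (y - x) * (y - (1 - x)) = 0 := by linear_combination h - j0
      simpa [sub_eq_zero] using this
    · intro h
      have hy : y ≠ 0 ∧ y ≠ 1 := by
        rcases h with rfl | rfl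
        all_goals constructor <;> grind
      refine ⟨hy, (J_eq_zero h2 hy.1 hy.2).2 ?_⟩
      rcases h with rfl | rfl
      · exact j0
      · linear_combination j0
  rw [this, Finset.card_pair]
  intro h
  apply h3
  linear_combination 4 * j0 - (2 * x - 1) * h

lemma image_card (h2 : (2 : F) ≠ 0) (h3 : (3 : F) ≠ 0) :
    ∃ m e : ℕ, e ≤ 1 ∧ Fintype.card F = 6 * m + 5 + 2 * e ∧
      ((S F).image J).card = m + 1 + e := by
  have h1728 : (1728 : F) ≠ 0 := by
    have : (1728 : F) = 2 ^ 6 * 3 ^ 3 := by norm_num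
    rw [this]; positivity
  have hm : (1728 : F) ∈ (S F).image J := by
    have : 0 < ((S F).filter fun y => J y = 1728).card := by rw [fib_1728 h2 h3]; norm_num
    obtain ⟨y, hy⟩ := Finset.card_pos.1 this
    rw [Finset.mem_filter] at hy
    exact Finset.mem_image.2 ⟨y, hy⟩
  have hs := Finset.card_eq_sum_card_image (J : F → F) (S F)
  have hc := card_S (F := F)
  have hr : ∀ T : Finset F, T ⊆ (S F).image J → 0 ∉ T → 1728 ∉ T →
      ∑ b ∈ T, ((S F).filter fun y => J y = b).card = 6 * T.card := by
    intro T hT z0 z1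
    rw [Finset.sum_const_nat (m := 6), mul_comm]
    intro b hb
    obtain ⟨x, hx, rfl⟩ := Finset.mem_image.1 (hT hb)
    exact fib_generic h2 hx (fun h => z0 (h ▸ hb)) (fun h => z1 (h ▸ hb))
  rw [← Finset.add_sum_erase _ _ hm, fib_1728 h2 h3] at hs
  have hcard := Finset.card_erase_add_one hm
  by_cases h0 : (0 : F) ∈ ((S F).image J).erase 1728
  · rw [← Finset.add_sum_erase _ _ h0, hr _ ((Finset.erase_subset _ _).trans
      (Finset.erase_subset _ _)) (by simp) (by simp)] at hs
    have hcard' := Finset.card_erase_add_one h0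
    obtain ⟨x, hx, hx0⟩ := Finset.mem_image.1 (Finset.mem_of_mem_erase h0)
    rw [fib_zero h2 h3 hx hx0] at hs
    exact ⟨(((S F).image J).erase 1728 |>.erase 0).card, 1, le_rfl, by omega, by omega⟩
  · rw [hr _ (Finset.erase_subset _ _) h0 (by simp)] at hs
    exact ⟨(((S F).image J).erase 1728).card, 0, by omega, by omega, by omega⟩

lemma set_eq (h2 : (2 : F) ≠ 0) :
    {j : F | ∃ a : F, a ^ 2 ≠ 4 ∧ j = 16 * (a ^ 2 + 12) ^ 3 / (a ^ 2 - 4) ^ 2} =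
      ((S F).image J : Finset F) := by
  have h4 : (4 : F) ≠ 0 := by
    have : (4 : F) = 2 ^ 2 := by norm_num
    rw [this]; exact pow_ne_zero _ h2
  have h16 : (16 : F) ≠ 0 := by
    have : (16 : F) = 2 ^ 4 := by norm_num
    rw [this]; exact pow_ne_zero _ h2
  ext j
  simp only [Set.mem_ofPred_eq, Finset.coe_image, Set.mem_image, Finset.mem_coe, mem_S]
  constructor
  · rintro ⟨a, ha, rfl⟩
    have p : a - 2 ≠ 0 := fun h => ha (by linear_combination (a + 2) * h)
    have m : a + 2 ≠ 0 := fun h => ha (by linear_combination (a - 2) * h)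
    have e : (a + 2) / (a - 2) - 1 = 4 / (a - 2) := by field_simp; ring
    have e' : ((a + 2) / (a - 2)) ^ 2 - (a + 2) / (a - 2) + 1 = (a ^ 2 + 12) / (a - 2) ^ 2 := by
      field_simp; ring
    refine ⟨(a + 2) / (a - 2), ⟨div_ne_zero m p, ?_⟩, ?_⟩
    · rw [← sub_ne_zero, e]; exact div_ne_zero h4 p
    · have : a ^ 2 - 4 = (a - 2) * (a + 2) := by ring
      unfold J
      rw [e, e', this]
      field_simp
      ring
  · rintro ⟨x, ⟨hx, hx1⟩, rfl⟩
    have a1 : x - 1 ≠ 0 := sub_ne_zero.2 hx1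
    have e : (2 * (x + 1) / (x - 1)) ^ 2 - 4 = 16 * x / (x - 1) ^ 2 := by field_simp; ring
    have e' : (2 * (x + 1) / (x - 1)) ^ 2 + 12 = 16 * (x ^ 2 - x + 1) / (x - 1) ^ 2 := by
      field_simp; ring
    refine ⟨2 * (x + 1) / (x - 1), ?_, ?_⟩
    · rw [← sub_ne_zero, e]; positivity
    · unfold J
      rw [e, e']
      field_simp
      ring

end JQ

/-- The number of distinct j-invariants of Jacobi quartic curves over `F_q`. -/
theorem jacobi_quartic_count {F : Type*} [Field F] [Fintype F] (q : ℕ)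
    (hq : Fintype.card F = q) (hchar : 3 < ringChar F) :
    (q % 12 = 1 ∨ q % 12 = 7 →
      {j : F | ∃ a : F, a ^ 2 ≠ 4 ∧
        j = 16 * (a ^ 2 + 12) ^ 3 / (a ^ 2 - 4) ^ 2}.ncard = (q + 5) / 6) ∧
    (q % 12 = 5 ∨ q % 12 = 11 →
      {j : F | ∃ a : F, a ^ 2 ≠ 4 ∧
        j = 16 * (a ^ 2 + 12) ^ 3 / (a ^ 2 - 4) ^ 2}.ncard = (q + 1) / 6) := by
  classical
  have hn : ∀ n : ℕ, 0 < n → n ≤ 3 → (n : F) ≠ 0 := by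
    intro n hn hn3 h
    have := Nat.le_of_dvd hn ((ringChar.spec F n).1 h)
    omega
  have h2 : (2 : F) ≠ 0 := by exact_mod_cast hn 2 (by norm_num) (by norm_num)
  have h3 : (3 : F) ≠ 0 := by exact_mod_cast hn 3 (by norm_num) (by norm_num)
  obtain ⟨m, e, he, hF, hI⟩ := JQ.image_card h2 h3
  rw [JQ.set_eq h2, Set.ncard_coe_finset, hI]
  constructor <;> intro h <;> omega
end

section
/- Let K be a field of characteristic greater than 3, and let a, b ∈ K with b·(a² − 4b) ≠ 0. For all u, v ∈ K satisfying v² = u·(u² − 2a·u + a² − 4b) and u ≠ 0, if x = v/(2u) and y = (v/(2u))² − (u − a)/2, then y² = x⁴ + a·x² + b. -/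
/-- Inverse direction of the birational equivalence between the general Jacobi
quartic curve `E_{a,b} : y² = x⁴ + a x² + b` and the Weierstrass curve
`W_{a,b} : v² = u (u² − 2 a u + a² − 4 b)`. -/
theorem weierstrass_to_general_jacobi_quartic {K : Type*} [Field K]
    (hchar : 3 < ringChar K) (a b : K) (hab : b * (a ^ 2 - 4 * b) ≠ 0)
    (u v : K) (huv : v ^ 2 = u * (u ^ 2 - 2 * a * u + a ^ 2 - 4 * b))
    (hu : u ≠ 0)
    (x y : K) (hx : x = v / (2 * u))
    (hy : y = (v / (2 * u)) ^ 2 - (u - a) / 2) :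
    y ^ 2 = x ^ 4 + a * x ^ 2 + b := by
  have h2 : (2 : K) ≠ 0 := Ring.two_ne_zero (by omega)
  have hX : 4 * u * x ^ 2 = (u - a) ^ 2 - 4 * b := by
    have h1 : x * (2 * u) = v := by
      rw [hx]
      exact div_mul_cancel₀ v (mul_ne_zero h2 hu)
    apply mul_left_cancel₀ hu
    rw [← h1] at huv
    linear_combination huv
  rw [← hx] at hy
  have hw : 2 * y = 2 * x ^ 2 - (u - a) := by
    rw [hy, mul_sub, mul_div_cancel₀ _ h2]
  apply mul_left_cancel₀ (mul_ne_zero h2 h2)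
  linear_combination (2 * y + 2 * x ^ 2 - (u - a)) * hw - hX
end

section
/- Let F_q be a finite field with q elements of characteristic greater than 3. The number of pairs (a, b) ∈ F_q × F_q such that b is a nonzero square in F_q, b·(a² − 4b) ≠ 0, a² + 12b ≠ 0, and a·(a² − 36b) ≠ 0 equals (q − 1)(q − 7)/2 if q ≡ 1 or 7 (mod 12), and equals (q − 1)(q − 5)/2 if q ≡ 5 or 11 (mod 12). -/
theorem cpbs_two_mul {F : Type*} [Field F] [Fintype F] [DecidableEq F]
    (h2 : (2 : F) ≠ 0) :
    2 * {p : F × F | (∃ d : F, d ≠ 0 ∧ p.2 = d ^ 2) ∧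
        p.2 * (p.1 ^ 2 - 4 * p.2) ≠ 0 ∧ p.1 ^ 2 + 12 * p.2 ≠ 0 ∧
        p.1 * (p.1 ^ 2 - 36 * p.2) ≠ 0}.ncard =
    (Fintype.card F - 1) * (Finset.univ.filter (fun t : F =>
      t ≠ 0 ∧ t ^ 2 ≠ 4 ∧ t ^ 2 ≠ -12 ∧ t ^ 2 ≠ 36)).card := by
  classical
  set T := Finset.univ.filter (fun t : F =>
      t ≠ 0 ∧ t ^ 2 ≠ 4 ∧ t ^ 2 ≠ -12 ∧ t ^ 2 ≠ 36) with hT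
  set D := (Finset.univ : Finset F).erase 0 with hD
  have hDc : D.card = Fintype.card F - 1 := by
    rw [hD, Finset.card_erase_of_mem (Finset.mem_univ _), Finset.card_univ]
  set S := Finset.univ.filter (fun p : F × F => (∃ d : F, d ≠ 0 ∧ p.2 = d ^ 2) ∧
        p.2 * (p.1 ^ 2 - 4 * p.2) ≠ 0 ∧ p.1 ^ 2 + 12 * p.2 ≠ 0 ∧
        p.1 * (p.1 ^ 2 - 36 * p.2) ≠ 0) with hS
  have hncard : {p : F × F | (∃ d : F, d ≠ 0 ∧ p.2 = d ^ 2) ∧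
        p.2 * (p.1 ^ 2 - 4 * p.2) ≠ 0 ∧ p.1 ^ 2 + 12 * p.2 ≠ 0 ∧
        p.1 * (p.1 ^ 2 - 36 * p.2) ≠ 0}.ncard = S.card := by
    rw [← Set.ncard_coe_finset]
    congr 1
    ext p
    simp [hS]
  rw [hncard, ← hDc, ← Finset.card_product]
  have key : ∀ t d : F, d ≠ 0 → (t ∈ T ↔ (d ^ 2 * ((t * d) ^ 2 - 4 * d ^ 2) ≠ 0 ∧
      (t * d) ^ 2 + 12 * d ^ 2 ≠ 0 ∧ (t * d) * ((t * d) ^ 2 - 36 * d ^ 2) ≠ 0)) := by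
    intro t d hd
    have e1 : d ^ 2 * ((t * d) ^ 2 - 4 * d ^ 2) = d ^ 4 * (t ^ 2 - 4) := by ring
    have e2 : (t * d) ^ 2 + 12 * d ^ 2 = d ^ 2 * (t ^ 2 - (-12)) := by ring
    have e3 : (t * d) * ((t * d) ^ 2 - 36 * d ^ 2) = d ^ 3 * (t * (t ^ 2 - 36)) := by ring
    rw [e1, e2, e3]
    simp only [hT, Finset.mem_filter, Finset.mem_univ, true_and, ne_eq, mul_eq_zero,
      hd, sub_eq_zero, false_or, pow_eq_zero_iff, OfNat.ofNat_ne_zero,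
      not_false_eq_true, not_or]
    tauto
  have hmaps : ∀ x ∈ D ×ˢ T, (fun x : F × F => (x.2 * x.1, x.1 ^ 2)) x ∈ S := by
    rintro ⟨d, t⟩ hx
    rw [Finset.mem_product] at hx
    have hd : d ≠ 0 := (Finset.mem_erase.1 hx.1).1
    simp only [hS, Finset.mem_filter, Finset.mem_univ, true_and]
    exact ⟨⟨d, hd, rfl⟩, (key t d hd).1 hx.2⟩
  rw [Finset.card_eq_sum_card_fiberwise hmaps]
  rw [Finset.sum_const_nat (m := 2), mul_comm]
  rintro ⟨a, b⟩ hab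
  simp only [hS, Finset.mem_filter, Finset.mem_univ, true_and] at hab
  obtain ⟨⟨d, hd, rfl⟩, h⟩ := hab
  obtain ⟨t, rfl⟩ : ∃ t, a = t * d := ⟨a / d, by field_simp⟩
  have ht := (key t d hd).2 h
  have ht' : -t ∈ T := by simpa [hT] using ht
  have : (D ×ˢ T).filter (fun x => (x.2 * x.1, x.1 ^ 2) = (t * d, d ^ 2)) =
      {(d, t), (-d, -t)} := by
    ext ⟨e, u⟩
    simp only [Finset.mem_filter, Finset.mem_product, Finset.mem_insert, Finset.mem_singleton,
      Prod.mk.injEq]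
    constructor
    · rintro ⟨-, h1, h2⟩
      rcases sq_eq_sq_iff_eq_or_eq_neg.1 h2 with rfl | rfl
      · exact Or.inl ⟨rfl, mul_right_cancel₀ hd h1⟩
      · refine Or.inr ⟨rfl, mul_right_cancel₀ hd ?_⟩
        linear_combination -h1
    · rintro (⟨rfl, rfl⟩ | ⟨rfl, rfl⟩)
      · exact ⟨⟨by simp [hD, hd], ht⟩, rfl, rfl⟩
      · exact ⟨⟨by simp [hD, hd], ht'⟩, by ring, by ring⟩
  rw [this, Finset.card_pair]
  intro hh
  have h1 : d = -d := (Prod.mk.inj hh).1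
  have : 2 * d = 0 := by linear_combination h1
  exact (mul_ne_zero h2 hd) this

theorem cpbs_exists {F : Type*} [Field F] [Fintype F] (h : Fintype.card F % 3 = 1) :
    ∃ s : F, s ^ 2 = -12 := by
  classical
  have hc : Fintype.card Fˣ = Fintype.card F - 1 := Fintype.card_units F
  have : Fact (Nat.Prime 3) := ⟨Nat.prime_three⟩
  obtain ⟨w, hw⟩ := exists_prime_orderOf_dvd_card (G := Fˣ) 3 (by omega)
  have hw3 : w ^ 3 = 1 := by rw [← hw]; exact pow_orderOf_eq_one w
  have hw1 : (w : F) ≠ 1 := by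
    intro h1
    have : w = 1 := Units.ext h1
    rw [this, orderOf_one] at hw
    omega
  have h3 : (w : F) ^ 3 = 1 := by simpa using congrArg Units.val hw3
  have h4 : (w : F) ^ 2 + w + 1 = 0 := by
    apply mul_left_cancel₀ (sub_ne_zero.2 hw1)
    linear_combination h3
  exact ⟨2 * (2 * w + 1), by linear_combination 16 * h4⟩

theorem cpbs_not_exists {F : Type*} [Field F] [Fintype F] (h : Fintype.card F % 3 = 2)
    (h2 : (2 : F) ≠ 0) (h3 : (3 : F) ≠ 0) (s : F) : s ^ 2 ≠ -12 := by
  classical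
  intro hs
  have hc : Fintype.card Fˣ = Fintype.card F - 1 := Fintype.card_units F
  obtain ⟨w, hw⟩ : ∃ w : F, s = 4 * w + 2 := by
    refine ⟨(s - 2) / 4, ?_⟩
    have : (4 : F) ≠ 0 := by
      have := mul_ne_zero h2 h2
      norm_num at this
      exact this
    field_simp
    ring
  subst hw
  have h4 : w ^ 2 + w + 1 = 0 := by
    have h16 : (16 : F) ≠ 0 := by
      have := pow_ne_zero 4 h2
      norm_num at this
      exact this
    apply mul_left_cancel₀ h16
    linear_combination hs
  have hw0 : w ≠ 0 := by rintro rfl; simp at h4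
  have hw3 : w ^ 3 = 1 := by linear_combination (w - 1) * h4
  have hw1 : w ≠ 1 := by
    rintro rfl
    apply h3
    linear_combination h4
  have : Fact (Nat.Prime 3) := ⟨Nat.prime_three⟩
  have ho : orderOf (Units.mk0 w hw0) = 3 := by
    apply orderOf_eq_prime
    · ext; simpa using hw3
    · intro hh
      exact hw1 (by simpa using congrArg Units.val hh)
  have hd := orderOf_dvd_card (x := Units.mk0 w hw0)
  rw [ho, hc] at hd
  omega

/-- The number of pairs `(a, b)` with `b` a nonzero square,
`b (a² − 4b) ≠ 0`, `a² + 12b ≠ 0` and `a (a² − 36b) ≠ 0` (i.e. the general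
Jacobi quartic curve `E_{a,b}` exists, has `j ∉ {0, 1728}` and `b` a nonzero
square). -/
theorem count_pairs_b_square {F : Type*} [Field F] [Fintype F] (q : ℕ)
    (hq : Fintype.card F = q) (hchar : 3 < ringChar F) :
    (q % 12 = 1 ∨ q % 12 = 7 →
      {p : F × F | (∃ d : F, d ≠ 0 ∧ p.2 = d ^ 2) ∧
        p.2 * (p.1 ^ 2 - 4 * p.2) ≠ 0 ∧ p.1 ^ 2 + 12 * p.2 ≠ 0 ∧
        p.1 * (p.1 ^ 2 - 36 * p.2) ≠ 0}.ncard = (q - 1) * (q - 7) / 2) ∧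
    (q % 12 = 5 ∨ q % 12 = 11 →
      {p : F × F | (∃ d : F, d ≠ 0 ∧ p.2 = d ^ 2) ∧
        p.2 * (p.1 ^ 2 - 4 * p.2) ≠ 0 ∧ p.1 ^ 2 + 12 * p.2 ≠ 0 ∧
        p.1 * (p.1 ^ 2 - 36 * p.2) ≠ 0}.ncard = (q - 1) * (q - 5) / 2) := by
  classical
  subst hq
  have hcast : ∀ n : ℕ, (n : F) = 0 → ringChar F ∣ n := fun n => (ringChar.spec F n).1
  have h2 : (2 : F) ≠ 0 := by
    intro h
    have := Nat.le_of_dvd (by norm_num) (hcast 2 (by exact_mod_cast h))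
    omega
  have h3 : (3 : F) ≠ 0 := by
    intro h
    have := Nat.le_of_dvd (by norm_num) (hcast 3 (by exact_mod_cast h))
    omega
  have main := cpbs_two_mul h2
  have hcompl : (Finset.univ.filter (fun t : F =>
      t ≠ 0 ∧ t ^ 2 ≠ 4 ∧ t ^ 2 ≠ -12 ∧ t ^ 2 ≠ 36)).card = Fintype.card F -
      (Finset.univ.filter (fun t : F => ¬ (
      t ≠ 0 ∧ t ^ 2 ≠ 4 ∧ t ^ 2 ≠ -12 ∧ t ^ 2 ≠ 36))).card := by
    have := Finset.card_filter_add_card_filter_not (s := (Finset.univ : Finset F)) (fun t : F =>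
      t ≠ 0 ∧ t ^ 2 ≠ 4 ∧ t ^ 2 ≠ -12 ∧ t ^ 2 ≠ 36)
    rw [Finset.card_univ] at this
    omega
  have e4 : ∀ t : F, t ^ 2 = 4 ↔ t = 2 ∨ t = -2 := by
    intro t
    rw [← sq_eq_sq_iff_eq_or_eq_neg]
    norm_num
  have e36 : ∀ t : F, t ^ 2 = 36 ↔ t = 6 ∨ t = -6 := by
    intro t
    rw [← sq_eq_sq_iff_eq_or_eq_neg]
    norm_num
  have n22 : (2 : F) ≠ -2 := fun h => pow_ne_zero 2 h2 (by linear_combination h)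
  have n26 : (2 : F) ≠ 6 := fun h => pow_ne_zero 2 h2 (by linear_combination -h)
  have n26' : (2 : F) ≠ -6 := fun h => pow_ne_zero 3 h2 (by linear_combination h)
  have n62 : (-2 : F) ≠ 6 := fun h => pow_ne_zero 3 h2 (by linear_combination -h)
  have n62' : (-2 : F) ≠ -6 := fun h => pow_ne_zero 2 h2 (by linear_combination h)
  have n6 : (6 : F) ≠ 0 := fun h => mul_ne_zero h2 h3 (by linear_combination h)
  have n66 : (6 : F) ≠ -6 := fun h => mul_ne_zero (pow_ne_zero 2 h2) h3 (by linear_combination h)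
  constructor
  · intro hm
    obtain ⟨s, hs⟩ := cpbs_exists (F := F) (by omega)
    have e12 : ∀ t : F, t ^ 2 = -12 ↔ t = s ∨ t = -s := by
      intro t
      rw [← sq_eq_sq_iff_eq_or_eq_neg, hs]
    have hset : (Finset.univ.filter (fun t : F => ¬ (
      t ≠ 0 ∧ t ^ 2 ≠ 4 ∧ t ^ 2 ≠ -12 ∧ t ^ 2 ≠ 36))) = {0, 2, -2, 6, -6, s, -s} := by
      ext t
      simp only [Finset.mem_filter, Finset.mem_univ, true_and, Finset.mem_insert,
        Finset.mem_singleton, ne_eq, e4, e12, e36]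
      tauto
    have s0 : s ≠ 0 := by
      rintro rfl
      exact mul_ne_zero (pow_ne_zero 2 h2) h3 (by linear_combination hs)
    have s4 : ¬ (s = 2 ∨ s = -2) := by
      rw [← e4, hs]
      intro h
      exact pow_ne_zero 4 h2 (by linear_combination -h)
    have s36 : ¬ (s = 6 ∨ s = -6) := by
      rw [← e36, hs]
      intro h
      exact mul_ne_zero (pow_ne_zero 4 h2) h3 (by linear_combination -h)
    have ss : s ≠ -s := fun h => mul_ne_zero h2 s0 (by linear_combination h)
    push Not at s4 s36
    have hcard : ({0, 2, -2, 6, -6, s, -s} : Finset F).card = 7 := by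
      have a1 : (2 : F) ≠ -s := fun h => s4.2 (by linear_combination h)
      have a2 : (-2 : F) ≠ -s := fun h => s4.1 (by linear_combination h)
      have a3 : (6 : F) ≠ -s := fun h => s36.2 (by linear_combination h)
      have a4 : (-6 : F) ≠ -s := fun h => s36.1 (by linear_combination h)
      have b1 : (0 : F) ≠ -2 := fun h => h2 (by linear_combination h)
      have b2 : (0 : F) ≠ -6 := fun h => n6 (by linear_combination h)
      have b3 : (0 : F) ≠ -s := fun h => s0 (by linear_combination h)
      repeat rw [Finset.card_insert_of_notMem]
      · rw [Finset.card_singleton]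
      all_goals simp only [Finset.mem_insert, Finset.mem_singleton, not_or]
      · exact ss
      · exact ⟨s36.2.symm, a4⟩
      · exact ⟨n66, s36.1.symm, a3⟩
      · exact ⟨n62, n62', s4.2.symm, a2⟩
      · exact ⟨n22, n26, n26', s4.1.symm, a1⟩
      · exact ⟨h2.symm, b1, n6.symm, b2, s0.symm, b3⟩
    rw [hcompl, hset, hcard] at main
    rw [← main]
    omega
  · intro hm
    have e12 : ∀ t : F, t ^ 2 ≠ -12 := cpbs_not_exists (by omega) h2 h3
    have hset : (Finset.univ.filter (fun t : F => ¬ (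
      t ≠ 0 ∧ t ^ 2 ≠ 4 ∧ t ^ 2 ≠ -12 ∧ t ^ 2 ≠ 36))) = {0, 2, -2, 6, -6} := by
      ext t
      have := e12 t
      simp only [Finset.mem_filter, Finset.mem_univ, true_and, Finset.mem_insert,
        Finset.mem_singleton, ne_eq, e4, e36]
      tauto
    have hcard : ({0, 2, -2, 6, -6} : Finset F).card = 5 := by
      have b1 : (0 : F) ≠ -2 := fun h => h2 (by linear_combination h)
      have b2 : (0 : F) ≠ -6 := fun h => n6 (by linear_combination h)
      repeat rw [Finset.card_insert_of_notMem]
      · rw [Finset.card_singleton]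
      all_goals simp only [Finset.mem_insert, Finset.mem_singleton, not_or]
      · exact n66
      · exact ⟨n62, n62'⟩
      · exact ⟨n22, n26, n26'⟩
      · exact ⟨h2.symm, b1, n6.symm, b2⟩
    rw [hcompl, hset, hcard] at main
    rw [← main]
    omega
end

section
/- Let F_q be a finite field with q elements of characteristic greater than 3. The number of pairs (a, b) ∈ F_q × F_q such that b is not a square in F_q, b·(a² − 4b) ≠ 0, a² + 12b ≠ 0, and a·(a² − 36b) ≠ 0 equals (q − 1)²/2 if q ≡ 1 or 7 (mod 12), and equals (q − 1)(q − 3)/2 if q ≡ 5 or 11 (mod 12). -/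
open Finset in
theorem two_mul_card_nonsq {F : Type*} [Field F] [Fintype F] [DecidableEq F]
    (h2 : ringChar F ≠ 2) :
    2 * (univ.filter (fun b : F => ¬ IsSquare b)).card + 1 = Fintype.card F := by
  have h := quadraticChar_sum_zero (F := F) h2
  have key : ∀ a : F, 1 - quadraticChar F a
      = 2 * (if ¬ IsSquare a then 1 else 0) + (if a = 0 then 1 else 0) := by
    intro a
    by_cases ha : a = 0
    · simp [ha]
    · by_cases hs : IsSquare a
      · simp [ha, hs, (quadraticChar_one_iff_isSquare ha).2 hs]
      · simp [ha, hs, quadraticChar_neg_one_iff_not_isSquare.2 hs]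
  have h3 : ∑ a : F, (1 - quadraticChar F a)
      = ∑ a : F, ((2 : ℤ) * (if ¬ IsSquare a then 1 else 0) + (if a = 0 then 1 else 0)) :=
    Finset.sum_congr rfl fun a _ => key a
  rw [Finset.sum_sub_distrib, h, Finset.sum_add_distrib, ← Finset.mul_sum,
    Finset.sum_boole, Finset.sum_ite_eq'] at h3
  simp only [Finset.sum_const, Finset.card_univ, Finset.mem_univ, if_true, nsmul_eq_mul,
    mul_one, sub_zero] at h3
  exact_mod_cast h3.symm

theorem isSquare_neg_three_iff_aux {F : Type*} [Field F] [Fintype F]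
    (h2 : (2 : F) ≠ 0) (h3 : (3 : F) ≠ 0) :
    (∃ s : F, s ^ 2 = -3) ↔ 3 ∣ Fintype.card F - 1 := by
  classical
  haveI : Fact (Nat.Prime 3) := ⟨Nat.prime_three⟩
  rw [← Fintype.card_units]
  constructor
  · rintro ⟨s, hs⟩
    have hw : ((-1 + s) / 2) ^ 3 = 1 := by
      field_simp
      linear_combination (s - 3) * hs
    have hw1 : (-1 + s) / 2 ≠ 1 := by
      intro h
      field_simp at h
      have hs3 : s = 3 := by linear_combination h
      rw [hs3] at hs
      have : (2 : F) * 2 * 3 = 0 := by linear_combination hs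
      simp [h2, h3] at this
    let u : Fˣ := Units.mk0 ((-1 + s) / 2) (by
      intro h; rw [h] at hw; norm_num at hw)
    have hu : orderOf u = 3 := orderOf_eq_prime (Units.ext (by simpa [u] using hw))
      (fun h => hw1 (by simpa [u] using congrArg Units.val h))
    rw [← hu]
    exact orderOf_dvd_card
  · intro h
    obtain ⟨u, hu⟩ := exists_prime_orderOf_dvd_card 3 h
    have h1 : (u : F) ^ 3 = 1 := by
      have := pow_orderOf_eq_one u
      rw [hu] at this
      simpa using congrArg Units.val this
    have hne : (u : F) - 1 ≠ 0 := by
      intro h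
      have : u = 1 := Units.ext (by simpa using sub_eq_zero.1 h)
      rw [this] at hu
      simp at hu
    refine ⟨2 * u + 1, ?_⟩
    apply mul_left_cancel₀ hne
    linear_combination 4 * h1

/-- The number of pairs `(a, b)` with `b` not a square,
`b (a² − 4b) ≠ 0`, `a² + 12b ≠ 0` and `a (a² − 36b) ≠ 0` (i.e. the general
Jacobi quartic curve `E_{a,b}` exists, has `j ∉ {0, 1728}` and `b` a
non-square). -/
theorem count_pairs_b_nonsquare {F : Type*} [Field F] [Fintype F] (q : ℕ)
    (hq : Fintype.card F = q) (hchar : 3 < ringChar F) :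
    (q % 12 = 1 ∨ q % 12 = 7 →
      {p : F × F | ¬ IsSquare p.2 ∧
        p.2 * (p.1 ^ 2 - 4 * p.2) ≠ 0 ∧ p.1 ^ 2 + 12 * p.2 ≠ 0 ∧
        p.1 * (p.1 ^ 2 - 36 * p.2) ≠ 0}.ncard = (q - 1) ^ 2 / 2) ∧
    (q % 12 = 5 ∨ q % 12 = 11 →
      {p : F × F | ¬ IsSquare p.2 ∧
        p.2 * (p.1 ^ 2 - 4 * p.2) ≠ 0 ∧ p.1 ^ 2 + 12 * p.2 ≠ 0 ∧
        p.1 * (p.1 ^ 2 - 36 * p.2) ≠ 0}.ncard = (q - 1) * (q - 3) / 2) := by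
  classical
  have hr2 : ringChar F ≠ 2 := by omega
  have ne : ∀ n : ℕ, 0 < n → n ≤ 3 → (n : F) ≠ 0 := by
    intro n h0 h3 h
    have := Nat.le_of_dvd h0 ((ringChar.spec F n).1 h)
    omega
  have h2 : (2 : F) ≠ 0 := by exact_mod_cast ne 2 (by norm_num) (by norm_num)
  have h3 : (3 : F) ≠ 0 := by exact_mod_cast ne 3 (by norm_num) (by norm_num)
  have h12 : (12 : F) ≠ 0 := by
    have : (12 : F) = 2 * 2 * 3 := by norm_num
    rw [this]; exact mul_ne_zero (mul_ne_zero h2 h2) h3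
  have h6 : (6 : F) ≠ 0 := by
    have : (6 : F) = 2 * 3 := by norm_num
    rw [this]; exact mul_ne_zero h2 h3
  have hN := two_mul_card_nonsq (F := F) hr2
  have h3iff := isSquare_neg_three_iff_aux h2 h3
  rw [hq] at hN h3iff
  set N := Finset.univ.filter (fun b : F => ¬ IsSquare b) with hNdef
  set A := Finset.univ.filter (fun a : F => a ≠ 0) with hAdef
  have hA : A.card = q - 1 := by
    rw [hAdef, Finset.filter_ne', Finset.card_erase_of_mem (Finset.mem_univ _),
      Finset.card_univ, hq]
  have hset : ∀ a b : F, (¬ IsSquare b ∧ b * (a ^ 2 - 4 * b) ≠ 0 ∧ a ^ 2 + 12 * b ≠ 0 ∧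
        a * (a ^ 2 - 36 * b) ≠ 0) ↔ (a ≠ 0 ∧ ¬ IsSquare b ∧ a ^ 2 + 12 * b ≠ 0) := by
    intro a b
    constructor
    · rintro ⟨h1, -, h4, h5⟩
      exact ⟨left_ne_zero_of_mul h5, h1, h4⟩
    · rintro ⟨h0, h1, h4⟩
      refine ⟨h1, mul_ne_zero ?_ ?_, h4, mul_ne_zero h0 ?_⟩
      · rintro rfl; exact h1 (IsSquare.zero)
      · intro h
        exact h1 ⟨a / 2, by field_simp; linear_combination -h⟩
      · intro h
        exact h1 ⟨a / 6, by field_simp; linear_combination -h⟩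
  constructor
  · intro hmod
    obtain ⟨s, hs⟩ := h3iff.2 (by omega)
    have hs0 : s ≠ 0 := by
      rintro rfl
      apply h3
      linear_combination hs
    have : {p : F × F | ¬ IsSquare p.2 ∧
        p.2 * (p.1 ^ 2 - 4 * p.2) ≠ 0 ∧ p.1 ^ 2 + 12 * p.2 ≠ 0 ∧
        p.1 * (p.1 ^ 2 - 36 * p.2) ≠ 0} = ((A ×ˢ N : Finset (F × F)) : Set (F × F)) := by
      ext ⟨a, b⟩
      simp only [Set.mem_setOf_eq, hset, Finset.coe_product, Set.mem_prod, Finset.mem_coe,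
        hAdef, hNdef, Finset.mem_filter, Finset.mem_univ, true_and]
      refine ⟨fun h => ⟨h.1, h.2.1⟩, fun h => ⟨h.1, h.2, fun h' => h.2 ⟨a / (2 * s), ?_⟩⟩⟩
      field_simp
      linear_combination 4 * b * hs - h'
    rw [this, Set.ncard_coe_finset, Finset.card_product, hA]
    have : q - 1 = 2 * N.card := by omega
    rw [this]
    symm
    apply Nat.div_eq_of_eq_mul_left (by norm_num)
    ring
  · intro hmod
    have hns : ¬ ∃ s : F, s ^ 2 = -3 := by
      rw [h3iff]; omega
    have hinj : Function.Injective (fun a : F => (a, -a ^ 2 / 12)) :=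
      fun a b h => congrArg Prod.fst h
    have hsub : A.image (fun a : F => (a, -a ^ 2 / 12)) ⊆ A ×ˢ N := by
      intro p hp
      obtain ⟨a, ha, rfl⟩ := Finset.mem_image.1 hp
      rw [Finset.mem_product]
      refine ⟨ha, ?_⟩
      have ha0 : a ≠ 0 := by simpa [hAdef] using ha
      simp only [hNdef, Finset.mem_filter, Finset.mem_univ, true_and]
      rintro ⟨r, hr⟩
      apply hns
      refine ⟨6 * r / a, ?_⟩
      field_simp at hr ⊢
      linear_combination -3 * hr
    have : {p : F × F | ¬ IsSquare p.2 ∧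
        p.2 * (p.1 ^ 2 - 4 * p.2) ≠ 0 ∧ p.1 ^ 2 + 12 * p.2 ≠ 0 ∧
        p.1 * (p.1 ^ 2 - 36 * p.2) ≠ 0} =
        (((A ×ˢ N) \ A.image (fun a : F => (a, -a ^ 2 / 12)) : Finset (F × F)) :
          Set (F × F)) := by
      ext ⟨a, b⟩
      simp only [Set.mem_setOf_eq, hset, Finset.mem_coe, Finset.mem_sdiff, Finset.mem_product,
        Finset.mem_image, Prod.mk.injEq,
        hAdef, hNdef, Finset.mem_filter, Finset.mem_univ, true_and]
      constructor
      · rintro ⟨h0, h1, h4⟩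
        refine ⟨⟨h0, h1⟩, ?_⟩
        rintro ⟨c, -, rfl, rfl⟩
        apply h4
        field_simp
        ring
      · rintro ⟨⟨h0, h1⟩, h4⟩
        refine ⟨h0, h1, fun h => h4 ⟨a, h0, rfl, ?_⟩⟩
        field_simp
        linear_combination -h
    rw [this, Set.ncard_coe_finset, Finset.card_sdiff_of_subset hsub, Finset.card_product,
      Finset.card_image_of_injective _ hinj, hA]
    obtain ⟨m, hm⟩ : ∃ m, N.card = m + 1 := ⟨N.card - 1, by omega⟩
    have e1 : q - 1 = 2 * (m + 1) := by omega
    have e3 : q - 3 = 2 * m := by omega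
    rw [e1, e3, hm]
    symm
    apply Nat.div_eq_of_eq_mul_left (by norm_num)
    have : 2 * (m + 1) * (m + 1) - 2 * (m + 1) = 2 * (m + 1) * m := by
      rw [Nat.sub_eq_iff_eq_add (by nlinarith)]; ring
    rw [this]; ring
end

section
/- Let F_q be a finite field with q elements of characteristic greater than 3, and let a, b ∈ F_q with b·(a² − 4b) ≠ 0, a² + 12b ≠ 0, and a·(a² − 36b) ≠ 0. Suppose that b is not a square in F_q. If n ∈ F_q satisfies n·(a² − 4n) ≠ 0 and 16·(a² + 12n)³/(n·(a² − 4n)²) = 16·(a² + 12b)³/(b·(a² − 4b)²), then n = b. -/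
/-- If `b` is not a square and `E_{a,b}` has `j ∉ {0, 1728}`, then any general
Jacobi quartic curve `E_{a,n}` with the same j-invariant as `E_{a,b}` has
`n = b`. -/
theorem general_jacobi_quartic_nonsquare_rigid {F : Type*} [Field F]
    [Fintype F] (hchar : 3 < ringChar F) (a b : F)
    (hab : b * (a ^ 2 - 4 * b) ≠ 0) (hj0 : a ^ 2 + 12 * b ≠ 0)
    (hj1728 : a * (a ^ 2 - 36 * b) ≠ 0) (hns : ¬ IsSquare b)
    (n : F) (hn : n * (a ^ 2 - 4 * n) ≠ 0)
    (hjeq : 16 * (a ^ 2 + 12 * n) ^ 3 / (n * (a ^ 2 - 4 * n) ^ 2) =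
      16 * (a ^ 2 + 12 * b) ^ 3 / (b * (a ^ 2 - 4 * b) ^ 2)) :
    n = b := by
  have h2 : (2 : F) ≠ 0 := Ring.two_ne_zero (by omega)
  have hb : b ≠ 0 := left_ne_zero_of_mul hab
  have hb' : a ^ 2 - 4 * b ≠ 0 := right_ne_zero_of_mul hab
  have hn0 : n ≠ 0 := left_ne_zero_of_mul hn
  have hn' : a ^ 2 - 4 * n ≠ 0 := right_ne_zero_of_mul hn
  have ha : a ≠ 0 := left_ne_zero_of_mul hj1728
  rw [div_eq_div_iff (mul_ne_zero hn0 (pow_ne_zero 2 hn'))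
    (mul_ne_zero hb (pow_ne_zero 2 hb'))] at hjeq
  by_contra hne
  -- the quotient of the cubic in `n` by `n - b` is a quadratic in `n`
  have hQ : -16 * a ^ 2 * (a ^ 2 - 36 * b) ^ 2 * n ^ 2
      + 8 * a ^ 4 * (a ^ 4 + 88 * a ^ 2 * b + 144 * b ^ 2) * n
      - (a ^ 2 - 4 * b) ^ 2 * a ^ 6 = 0 := by
    have h16 : (2 : F) ^ 4 * (n - b) ≠ 0 := mul_ne_zero (pow_ne_zero 4 h2) (sub_ne_zero.mpr hne)
    apply (mul_eq_zero.mp _).resolve_left h16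
    linear_combination hjeq
  -- its discriminant is `b` times a nonzero square
  have hs : 2 ^ 7 * a ^ 5 * (a ^ 2 + 12 * b) ≠ 0 :=
    mul_ne_zero (mul_ne_zero (pow_ne_zero 7 h2) (pow_ne_zero 5 ha)) hj0
  apply hns
  refine ⟨(2 * (-16 * a ^ 2 * (a ^ 2 - 36 * b) ^ 2) * n
      + 8 * a ^ 4 * (a ^ 4 + 88 * a ^ 2 * b + 144 * b ^ 2))
      / (2 ^ 7 * a ^ 5 * (a ^ 2 + 12 * b)), ?_⟩
  rw [div_mul_div_comm, eq_div_iff (mul_ne_zero hs hs)]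
  linear_combination -4 * (-16 * a ^ 2 * (a ^ 2 - 36 * b) ^ 2) * hQ
end

section
/- Let F_q be a finite field with q elements of characteristic greater than 3, and let a, b ∈ F_q with b·(a² − 4b) ≠ 0, a² + 12b ≠ 0, and a·(a² − 36b) ≠ 0. Suppose b = d² for some nonzero d ∈ F_q. Then the set of n ∈ F_q with n·(a² − 4n) ≠ 0 and 16·(a² + 12n)³/(n·(a² − 4n)²) = 16·(a² + 12b)³/(b·(a² − 4b)²) is exactly {b, a²·(a − 2d)²/(4·(a + 6d)²), a²·(a + 2d)²/(4·(a − 6d)²)}, and these three elements are pairwise distinct, so this set has exactly 3 elements. -/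
/-- If `b = d²` is a nonzero square and `E_{a,b}` has `j ∉ {0, 1728}`, then the
set of `n` such that `E_{a,n}` is a general Jacobi quartic curve with the same
j-invariant as `E_{a,b}` is exactly
`{b, a²(a − 2d)²/(4(a + 6d)²), a²(a + 2d)²/(4(a − 6d)²)}`, whose three listed
elements are pairwise distinct, so it has exactly `3` elements. -/
theorem general_jacobi_quartic_square_fibre {F : Type*} [Field F] [Fintype F]
    (hchar : 3 < ringChar F) (a b : F) (hab : b * (a ^ 2 - 4 * b) ≠ 0)
    (hj0 : a ^ 2 + 12 * b ≠ 0) (hj1728 : a * (a ^ 2 - 36 * b) ≠ 0)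
    (d : F) (hd : d ≠ 0) (hbd : b = d ^ 2) :
    {n : F | n * (a ^ 2 - 4 * n) ≠ 0 ∧
        16 * (a ^ 2 + 12 * n) ^ 3 / (n * (a ^ 2 - 4 * n) ^ 2) =
          16 * (a ^ 2 + 12 * b) ^ 3 / (b * (a ^ 2 - 4 * b) ^ 2)} =
      ({b, a ^ 2 * (a - 2 * d) ^ 2 / (4 * (a + 6 * d) ^ 2),
        a ^ 2 * (a + 2 * d) ^ 2 / (4 * (a - 6 * d) ^ 2)} : Set F) ∧
    b ≠ a ^ 2 * (a - 2 * d) ^ 2 / (4 * (a + 6 * d) ^ 2) ∧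
    b ≠ a ^ 2 * (a + 2 * d) ^ 2 / (4 * (a - 6 * d) ^ 2) ∧
    a ^ 2 * (a - 2 * d) ^ 2 / (4 * (a + 6 * d) ^ 2) ≠
      a ^ 2 * (a + 2 * d) ^ 2 / (4 * (a - 6 * d) ^ 2) ∧
    {n : F | n * (a ^ 2 - 4 * n) ≠ 0 ∧
        16 * (a ^ 2 + 12 * n) ^ 3 / (n * (a ^ 2 - 4 * n) ^ 2) =
          16 * (a ^ 2 + 12 * b) ^ 3 / (b * (a ^ 2 - 4 * b) ^ 2)}.ncard = 3 := by
  subst hbd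
  have h2 : (2 : F) ≠ 0 := by
    intro h
    have h' : ((2 : ℕ) : F) = 0 := by exact_mod_cast h
    have := Nat.le_of_dvd (by norm_num) ((ringChar.spec F 2).1 h')
    omega
  have ha : a ≠ 0 := left_ne_zero_of_mul hj1728
  have h36 := right_ne_zero_of_mul hj1728
  have h4 := right_ne_zero_of_mul hab
  have hp6 : a + 6 * d ≠ 0 := fun h => h36 (by linear_combination (a - 6 * d) * h)
  have hm6 : a - 6 * d ≠ 0 := fun h => h36 (by linear_combination (a + 6 * d) * h)
  have hp2 : a + 2 * d ≠ 0 := fun h => h4 (by linear_combination (a - 2 * d) * h)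
  have hm2 : a - 2 * d ≠ 0 := fun h => h4 (by linear_combination (a + 2 * d) * h)
  have h4' : (4 : F) ≠ 0 := by
    have := pow_ne_zero 2 h2
    norm_num at this
    exact this
  have hD1 : 4 * (a + 6 * d) ^ 2 ≠ 0 := mul_ne_zero h4' (pow_ne_zero 2 hp6)
  have hD2 : 4 * (a - 6 * d) ^ 2 ≠ 0 := mul_ne_zero h4' (pow_ne_zero 2 hm6)
  have h16 : (16 : F) ≠ 0 := by
    have := pow_ne_zero 4 h2
    norm_num at this
    exact this
  have hset : {n : F | n * (a ^ 2 - 4 * n) ≠ 0 ∧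
        16 * (a ^ 2 + 12 * n) ^ 3 / (n * (a ^ 2 - 4 * n) ^ 2) =
          16 * (a ^ 2 + 12 * d ^ 2) ^ 3 / (d ^ 2 * (a ^ 2 - 4 * d ^ 2) ^ 2)} =
      ({d ^ 2, a ^ 2 * (a - 2 * d) ^ 2 / (4 * (a + 6 * d) ^ 2),
        a ^ 2 * (a + 2 * d) ^ 2 / (4 * (a - 6 * d) ^ 2)} : Set F) := by
    ext n
    simp only [Set.mem_setOf_eq, Set.mem_insert_iff, Set.mem_singleton_iff]
    rw [eq_div_iff hD1, eq_div_iff hD2]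
    have hb0 : d ^ 2 * (a ^ 2 - 4 * d ^ 2) ^ 2 ≠ 0 :=
      mul_ne_zero (pow_ne_zero 2 hd) (pow_ne_zero 2 h4)
    constructor
    · rintro ⟨hn, h⟩
      have hn0 : n * (a ^ 2 - 4 * n) ^ 2 ≠ 0 :=
        mul_ne_zero (left_ne_zero_of_mul hn) (pow_ne_zero 2 (right_ne_zero_of_mul hn))
      rw [div_eq_div_iff hn0 hb0] at h
      have hprod : 16 * a ^ 2 * ((n - d ^ 2) * ((n * (4 * (a + 6 * d) ^ 2) - a ^ 2 * (a - 2 * d) ^ 2)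
          * (n * (4 * (a - 6 * d) ^ 2) - a ^ 2 * (a + 2 * d) ^ 2))) = 0 := by
        linear_combination -h
      have := (mul_eq_zero.1 hprod).resolve_left (mul_ne_zero h16 (pow_ne_zero 2 ha))
      rcases mul_eq_zero.1 this with h | h
      · exact Or.inl (sub_eq_zero.1 h)
      · rcases mul_eq_zero.1 h with h | h
        · exact Or.inr (Or.inl (sub_eq_zero.1 h))
        · exact Or.inr (Or.inr (sub_eq_zero.1 h))
    · intro h
      have hn : n * (a ^ 2 - 4 * n) ≠ 0 := by
        rcases h with h | h | h
        · rw [h]; exact hab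
        · apply mul_ne_zero
          · rintro rfl
            exact mul_ne_zero (pow_ne_zero 2 ha) (pow_ne_zero 2 hm2) (by linear_combination -h)
          · intro h0
            apply mul_ne_zero (mul_ne_zero h16 (pow_ne_zero 2 ha)) (mul_ne_zero hd hp2)
            linear_combination (a + 6 * d) ^ 2 * h0 + h
        · apply mul_ne_zero
          · rintro rfl
            exact mul_ne_zero (pow_ne_zero 2 ha) (pow_ne_zero 2 hp2) (by linear_combination -h)
          · intro h0
            apply mul_ne_zero (mul_ne_zero h16 (pow_ne_zero 2 ha)) (mul_ne_zero hd hm2)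
            linear_combination -(a - 6 * d) ^ 2 * h0 - h
      refine ⟨hn, ?_⟩
      have hn0 : n * (a ^ 2 - 4 * n) ^ 2 ≠ 0 :=
        mul_ne_zero (left_ne_zero_of_mul hn) (pow_ne_zero 2 (right_ne_zero_of_mul hn))
      rw [div_eq_div_iff hn0 hb0]
      have hprod : (n - d ^ 2) * ((n * (4 * (a + 6 * d) ^ 2) - a ^ 2 * (a - 2 * d) ^ 2)
          * (n * (4 * (a - 6 * d) ^ 2) - a ^ 2 * (a + 2 * d) ^ 2)) = 0 := by
        rcases h with h | h | h <;> rw [h] <;> ring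
      linear_combination -16 * a ^ 2 * hprod
  have h12 : d ^ 2 ≠ a ^ 2 * (a - 2 * d) ^ 2 / (4 * (a + 6 * d) ^ 2) := by
    rw [Ne, eq_div_iff hD1]
    intro h
    exact mul_ne_zero (mul_ne_zero hm6 hp2) hj0 (by linear_combination -h)
  have h13 : d ^ 2 ≠ a ^ 2 * (a + 2 * d) ^ 2 / (4 * (a - 6 * d) ^ 2) := by
    rw [Ne, eq_div_iff hD2]
    intro h
    exact mul_ne_zero (mul_ne_zero hp6 hm2) hj0 (by linear_combination -h)
  have h23 : a ^ 2 * (a - 2 * d) ^ 2 / (4 * (a + 6 * d) ^ 2) ≠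
      a ^ 2 * (a + 2 * d) ^ 2 / (4 * (a - 6 * d) ^ 2) := by
    rw [Ne, div_eq_div_iff hD1 hD2]
    intro h
    apply mul_ne_zero (mul_ne_zero (mul_ne_zero h16 (pow_ne_zero 3 h2)) (pow_ne_zero 3 ha)) (mul_ne_zero hd hj0)
    linear_combination -h
  refine ⟨hset, h12, h13, h23, ?_⟩
  rw [hset, Set.ncard_eq_three]
  exact ⟨_, _, _, h12, h13, h23, rfl⟩
end

section
/- Let F_q be a finite field with q elements of characteristic greater than 3. The number of distinct values of 16·(a² + 12b)³/(b·(a² − 4b)²) as (a, b) ranges over pairs in F_q × F_q with b not a square in F_q, b·(a² − 4b) ≠ 0, a² + 12b ≠ 0, and a·(a² − 36b) ≠ 0 equals (q − 1)/2 if q ≡ 1 or 7 (mod 12), and equals (q − 3)/2 if q ≡ 5 or 11 (mod 12). -/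
lemma card_nonsq {F : Type*} [Field F] [Fintype F] (hF : ringChar F ≠ 2) :
    2 * {u : F | ¬ IsSquare u}.ncard + 1 = Fintype.card F := by
  classical
  have h0 := quadraticChar_sum_zero (F := F) hF
  have key : ∀ a : F, 2 * (if ¬ IsSquare a then (1 : ℤ) else 0) + (if a = 0 then 1 else 0)
      + quadraticChar F a = 1 := by
    intro a
    by_cases ha : a = 0
    · subst ha; simp
    · by_cases hs : IsSquare a
      · have := (quadraticChar_one_iff_isSquare ha).2 hs
        simp [ha, hs, this]
      · have := quadraticChar_neg_one_iff_not_isSquare.2 hs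
        simp [ha, hs, this]
  have hs := Finset.sum_congr (rfl : (Finset.univ : Finset F) = Finset.univ) (fun a _ => key a)
  rw [Finset.sum_add_distrib, Finset.sum_add_distrib, h0, ← Finset.mul_sum,
    Finset.sum_boole, Finset.sum_ite_eq'] at hs
  have hc : {u : F | ¬ IsSquare u}.ncard = (Finset.univ.filter (fun u : F => ¬ IsSquare u)).card := by
    rw [← Set.ncard_coe_finset]; simp
  rw [hc]
  simp only [Finset.mem_univ, if_true, Finset.sum_const, Finset.card_univ, nsmul_eq_mul,
    mul_one, add_zero] at hs
  exact_mod_cast hs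

lemma neg_three_sq {F : Type*} [Field F] [Fintype F] (h2 : (2 : F) ≠ 0) (h3 : (3 : F) ≠ 0) :
    IsSquare (-3 : F) ↔ 3 ∣ Fintype.card F - 1 := by
  classical
  have hcard : Fintype.card Fˣ = Fintype.card F - 1 := Fintype.card_units F
  haveI : Fact (Nat.Prime 3) := ⟨Nat.prime_three⟩
  constructor
  · rintro ⟨s, hs⟩
    have hw3 : ((-1 + s) / 2) ^ 3 = 1 := by
      field_simp
      linear_combination (3 - s) * hs
    have hw1 : ((-1 + s) / 2) ≠ 1 := by
      intro h
      have h' : s = 3 := by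
        field_simp at h
        linear_combination h
      rw [h'] at hs
      have : (2 : F) * 2 * 3 = 0 := by linear_combination -hs
      simp [h2, h3] at this
    have ho : orderOf ((-1 + s) / 2) = 3 := orderOf_eq_prime hw3 hw1
    have hw0 : ((-1 + s) / 2) ≠ 0 := by
      intro h; rw [h] at hw3; simp at hw3
    have : orderOf (Units.mk0 _ hw0) = 3 := by rw [← orderOf_units]; exact ho
    rw [← hcard, ← this]
    exact orderOf_dvd_card
  · intro h
    rw [← hcard] at h
    obtain ⟨w, hw⟩ := exists_prime_orderOf_dvd_card 3 h
    have hw3 : (w : F) ^ 3 = 1 := by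
      rw [← Units.val_pow_eq_pow_val, ← hw, pow_orderOf_eq_one]; rfl
    have hw1 : (w : F) ≠ 1 := by
      intro h
      have : w = 1 := Units.ext h
      rw [this] at hw; simp at hw
    have hz : (w : F) ^ 2 + w + 1 = 0 := by
      have : ((w : F) - 1) * ((w : F) ^ 2 + w + 1) = 0 := by linear_combination hw3
      exact (mul_eq_zero.1 this).resolve_left (sub_ne_zero.2 hw1)
    exact ⟨2 * w + 1, by linear_combination -4 * hz⟩

lemma j_set_eq {F : Type*} [Field F] (h2 : (2 : F) ≠ 0) (h3 : (3 : F) ≠ 0) :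
    {j : F | ∃ a b : F, ¬ IsSquare b ∧ b * (a ^ 2 - 4 * b) ≠ 0 ∧
        a ^ 2 + 12 * b ≠ 0 ∧ a * (a ^ 2 - 36 * b) ≠ 0 ∧
        j = 16 * (a ^ 2 + 12 * b) ^ 3 / (b * (a ^ 2 - 4 * b) ^ 2)} =
      (fun u : F => 16 * (u + 12) ^ 3 / (u - 4) ^ 2) '' ({u : F | ¬ IsSquare u} \ {-12}) := by
  ext j
  simp only [Set.mem_setOf_eq, Set.mem_image, Set.mem_diff, Set.mem_singleton_iff]
  constructor
  · rintro ⟨a, b, hb, h4, h12, h36, rfl⟩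
    have hb0 : b ≠ 0 := left_ne_zero_of_mul h4
    have ha0 : a ≠ 0 := left_ne_zero_of_mul h36
    have h4' : a ^ 2 - 4 * b ≠ 0 := right_ne_zero_of_mul h4
    refine ⟨a ^ 2 / b, ⟨?_, ?_⟩, ?_⟩
    · rintro ⟨s, hs⟩
      apply hb
      have hs0 : s ≠ 0 := by
        rintro rfl
        simp [ha0, hb0] at hs
      refine ⟨a / s, ?_⟩
      field_simp at hs ⊢
      linear_combination -hs
    · intro h
      apply h12
      field_simp at h
      linear_combination h
    · have e1 : a ^ 2 / b + 12 = (a ^ 2 + 12 * b) / b := by field_simp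
      have e2 : a ^ 2 / b - 4 = (a ^ 2 - 4 * b) / b := by field_simp
      rw [e1, e2]
      field_simp
  · rintro ⟨u, ⟨hu, h12⟩, rfl⟩
    have hu0 : u ≠ 0 := by rintro rfl; simp at hu
    have hu4 : u - 4 ≠ 0 := by
      intro h; exact hu ⟨2, by linear_combination h⟩
    have hu36 : u - 36 ≠ 0 := by
      intro h; exact hu ⟨6, by linear_combination h⟩
    have hu12 : u + 12 ≠ 0 := fun h => h12 (by linear_combination h)
    have e4 : u ^ 2 - 4 * u = u * (u - 4) := by ring
    have e12 : u ^ 2 + 12 * u = u * (u + 12) := by ring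
    have e36 : u ^ 2 - 36 * u = u * (u - 36) := by ring
    refine ⟨u, u, hu, ?_, ?_, ?_, ?_⟩
    · rw [e4]; simp [hu0, hu4]
    · rw [e12]; simp [hu0, hu12]
    · rw [e36]; simp [hu0, hu36]
    · rw [e4, e12]; field_simp

lemma j_injOn {F : Type*} [Field F] (h2 : (2 : F) ≠ 0) :
    Set.InjOn (fun u : F => 16 * (u + 12) ^ 3 / (u - 4) ^ 2)
      ({u : F | ¬ IsSquare u} \ {-12}) := by
  rintro u ⟨hu, h12⟩ v ⟨hv, -⟩ huv
  simp only [Set.mem_setOf_eq, Set.mem_singleton_iff] at hu h12 hv huv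
  have hu4 : u - 4 ≠ 0 := by
    intro h; exact hu ⟨2, by linear_combination h⟩
  have hv4 : v - 4 ≠ 0 := by
    intro h; exact hv ⟨2, by linear_combination h⟩
  have hu12 : u + 12 ≠ 0 := fun h => h12 (by linear_combination h)
  have h16 : (16 : F) ≠ 0 := by
    have : (16 : F) = 2 ^ 4 := by norm_num
    rw [this]; exact pow_ne_zero _ h2
  have h128 : (128 : F) ≠ 0 := by
    have : (128 : F) = 2 ^ 7 := by norm_num
    rw [this]; exact pow_ne_zero _ h2
  rw [div_eq_div_iff (pow_ne_zero _ hu4) (pow_ne_zero _ hv4)] at huv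
  by_contra hne
  have hquad : ((u - 4) ^ 2 * (v - 4) ^ 2 - 768 * (u - 4) * (v - 4)
      - 4096 * ((u - 4) + (v - 4))) = 0 := by
    have h : (16 * (u - v)) * ((u - 4) ^ 2 * (v - 4) ^ 2 - 768 * (u - 4) * (v - 4)
      - 4096 * ((u - 4) + (v - 4))) = 0 := by linear_combination huv
    exact (mul_eq_zero.1 h).resolve_left (mul_ne_zero h16 (sub_ne_zero.2 hne))
  apply hu
  refine ⟨(2 * (u - 4) ^ 2 * (v - 4) - (768 * (u - 4) + 4096)) / (128 * (u + 12)), ?_⟩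
  field_simp
  linear_combination -4 * (u - 4) ^ 2 * hquad

lemma count_aux {F : Type*} [Field F] [Fintype F] (hchar : 3 < ringChar F) :
    (Fintype.card F % 3 = 1 →
      {j : F | ∃ a b : F, ¬ IsSquare b ∧ b * (a ^ 2 - 4 * b) ≠ 0 ∧
        a ^ 2 + 12 * b ≠ 0 ∧ a * (a ^ 2 - 36 * b) ≠ 0 ∧
        j = 16 * (a ^ 2 + 12 * b) ^ 3 / (b * (a ^ 2 - 4 * b) ^ 2)}.ncard =
        (Fintype.card F - 1) / 2) ∧
    (Fintype.card F % 3 = 2 →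
      {j : F | ∃ a b : F, ¬ IsSquare b ∧ b * (a ^ 2 - 4 * b) ≠ 0 ∧
        a ^ 2 + 12 * b ≠ 0 ∧ a * (a ^ 2 - 36 * b) ≠ 0 ∧
        j = 16 * (a ^ 2 + 12 * b) ^ 3 / (b * (a ^ 2 - 4 * b) ^ 2)}.ncard =
        (Fintype.card F - 3) / 2) := by
  have h2 : (2 : F) ≠ 0 := by
    intro h
    have := Nat.le_of_dvd (by norm_num) ((ringChar.spec F 2).1 (by exact_mod_cast h))
    omega
  have h3 : (3 : F) ≠ 0 := by
    intro h
    have := Nat.le_of_dvd (by norm_num) ((ringChar.spec F 3).1 (by exact_mod_cast h))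
    omega
  have hc := card_nonsq (F := F) (by omega)
  have hn := neg_three_sq (F := F) h2 h3
  have h12 : IsSquare (-12 : F) ↔ IsSquare (-3 : F) := by
    constructor
    · rintro ⟨s, hs⟩
      exact ⟨s / 2, by field_simp; linear_combination hs⟩
    · rintro ⟨s, hs⟩
      exact ⟨2 * s, by linear_combination 4 * hs⟩
  rw [j_set_eq h2 h3, Set.InjOn.ncard_image (j_injOn h2)]
  constructor
  · intro h
    have : IsSquare (-12 : F) := h12.2 (hn.2 (by omega))
    rw [Set.sdiff_singleton_eq_self (by simpa using this)]
    omega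
  · intro h
    have : ¬ IsSquare (-12 : F) := fun h' => by
      have := hn.1 (h12.1 h')
      omega
    rw [Set.ncard_sdiff_singleton_of_mem (by simpa using this)]
    omega

/-- The number of distinct j-invariants of general Jacobi quartic curves
`E_{a,b}` with `b` not a square and `j ∉ {0, 1728}`. -/
theorem count_j_b_nonsquare {F : Type*} [Field F] [Fintype F] (q : ℕ)
    (hq : Fintype.card F = q) (hchar : 3 < ringChar F) :
    (q % 12 = 1 ∨ q % 12 = 7 →
      {j : F | ∃ a b : F, ¬ IsSquare b ∧ b * (a ^ 2 - 4 * b) ≠ 0 ∧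
        a ^ 2 + 12 * b ≠ 0 ∧ a * (a ^ 2 - 36 * b) ≠ 0 ∧
        j = 16 * (a ^ 2 + 12 * b) ^ 3 / (b * (a ^ 2 - 4 * b) ^ 2)}.ncard =
        (q - 1) / 2) ∧
    (q % 12 = 5 ∨ q % 12 = 11 →
      {j : F | ∃ a b : F, ¬ IsSquare b ∧ b * (a ^ 2 - 4 * b) ≠ 0 ∧
        a ^ 2 + 12 * b ≠ 0 ∧ a * (a ^ 2 - 36 * b) ≠ 0 ∧
        j = 16 * (a ^ 2 + 12 * b) ^ 3 / (b * (a ^ 2 - 4 * b) ^ 2)}.ncard =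
        (q - 3) / 2) := by
  subst hq
  exact ⟨fun h => (count_aux hchar).1 (by omega), fun h => (count_aux hchar).2 (by omega)⟩
end

section
/- Let F_q be a finite field with q elements of characteristic greater than 3. The number of distinct values of 16·(a² + 12b)³/(b·(a² − 4b)²) as (a, b) ranges over pairs in F_q × F_q with b a nonzero square in F_q, b·(a² − 4b) ≠ 0, a² + 12b ≠ 0, and a·(a² − 36b) ≠ 0 equals (q − 7)/6 if q ≡ 1 or 7 (mod 12), and equals (q − 5)/6 if q ≡ 5 or 11 (mod 12). -/
section helpers
variable {F : Type*} [Field F]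

/-- The Legendre form of the j-invariant. -/
def JL (l : F) : F := 256 * (l ^ 2 - l + 1) ^ 3 / (l ^ 2 * (1 - l) ^ 2)

def Good (l : F) : Prop :=
  l ≠ 0 ∧ l ≠ 1 ∧ l ≠ -1 ∧ l ≠ 2 ∧ 2 * l ≠ 1 ∧ l ^ 2 - l + 1 ≠ 0

lemma two_three (hchar : 3 < ringChar F) : (2 : F) ≠ 0 ∧ (3 : F) ≠ 0 := by
  constructor
  · intro h
    have := (ringChar.spec F 2).1 (by exact_mod_cast h)
    have := Nat.le_of_dvd (by norm_num) this
    omega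
  · intro h
    have := (ringChar.spec F 3).1 (by exact_mod_cast h)
    have := Nat.le_of_dvd (by norm_num) this
    omega

lemma JL_eq_iff (h2 : (2 : F) ≠ 0) {l x : F} (hl0 : l ≠ 0) (hl1 : l ≠ 1)
    (hx0 : x ≠ 0) (hx1 : x ≠ 1) :
    JL x = JL l ↔ x = l ∨ x = 1 - l ∨ x = 1 / l ∨ x = 1 / (1 - l) ∨ x = (l - 1) / l ∨
      x = l / (l - 1) := by
  have a1 : 1 - l ≠ 0 := sub_ne_zero.2 (Ne.symm hl1)
  have a2 : l - 1 ≠ 0 := sub_ne_zero.2 hl1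
  have a3 : 1 - x ≠ 0 := sub_ne_zero.2 (Ne.symm hx1)
  have h256 : (256 : F) ≠ 0 := by
    have : (256 : F) = 2 ^ 8 := by norm_num
    rw [this]; exact pow_ne_zero _ h2
  have key : JL x = JL l ↔
      (x - l) * ((x - (1 - l)) * ((x * l - 1) * ((x * (1 - l) - 1) * ((x * l - (l - 1)) *
        (x * (l - 1) - l))))) = 0 := by
    unfold JL
    rw [div_eq_div_iff (mul_ne_zero (pow_ne_zero _ hx0) (pow_ne_zero _ a3))
      (mul_ne_zero (pow_ne_zero _ hl0) (pow_ne_zero _ a1))]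
    constructor
    · intro h
      have : (256 : F) * ((x - l) * ((x - (1 - l)) * ((x * l - 1) * ((x * (1 - l) - 1) *
        ((x * l - (l - 1)) * (x * (l - 1) - l)))))) = 0 := by linear_combination -h
      exact (mul_eq_zero.1 this).resolve_left h256
    · intro h
      linear_combination -256 * h
  rw [key, eq_div_iff hl0, eq_div_iff a1, eq_div_iff hl0, eq_div_iff a2]
  simp only [mul_eq_zero, sub_eq_zero]

lemma Good.orbit {l : F} (h : Good l) (h2 : (2 : F) ≠ 0) :
    Good (1 - l) ∧ Good (1 / l) := by
  obtain ⟨h0, h1, hm, h22, hh, hq⟩ := h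
  constructor
  · refine ⟨?_, ?_, ?_, ?_, ?_, ?_⟩
    · exact sub_ne_zero.2 (Ne.symm h1)
    · intro h; apply h0; linear_combination -h
    · intro h; apply h22; linear_combination -h
    · intro h; apply hm; linear_combination -h
    · intro h; apply hh; linear_combination -h
    · intro h; apply hq; linear_combination h
  · refine ⟨?_, ?_, ?_, ?_, ?_, ?_⟩
    · exact one_div_ne_zero h0
    · intro h; rw [div_eq_iff h0] at h; apply h1; linear_combination -h
    · intro h; rw [div_eq_iff h0] at h; apply hm; linear_combination h
    · intro h; rw [div_eq_iff h0] at h; apply hh; linear_combination -h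
    · intro h; field_simp at h; apply h22; linear_combination -h
    · intro h; field_simp at h; apply hq; linear_combination h

lemma fiber_card [Fintype F] [DecidableEq F] [DecidablePred (Good (F := F))]
    (h2 : (2 : F) ≠ 0) {l : F} (h : Good l) :
    (((Finset.univ.filter Good).filter (fun x : F => JL x = JL l))).card = 6 := by
  have g1 := (h.orbit h2).1
  have g2 := (h.orbit h2).2
  have g3 := (g1.orbit h2).2
  have g4 := (g2.orbit h2).1
  have g5 := (g3.orbit h2).1
  have h' := h
  obtain ⟨h0, h1, hm, h22, hh, hq⟩ := h
  have a1 : 1 - l ≠ 0 := sub_ne_zero.2 (Ne.symm h1)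
  have a2 : l - 1 ≠ 0 := sub_ne_zero.2 h1
  have e4 : 1 - 1 / l = (l - 1) / l := by field_simp
  have e5 : 1 - 1 / (1 - l) = l / (l - 1) := by
    rw [eq_div_iff a2, sub_mul, div_mul_eq_mul_div, sub_eq_iff_eq_add, ← sub_eq_iff_eq_add', eq_div_iff a1]
    ring
  rw [e4] at g4
  rw [e5] at g5
  have : (Finset.univ.filter Good).filter (fun x : F => JL x = JL l) =
      {l, 1 - l, 1 / l, 1 / (1 - l), (l - 1) / l, l / (l - 1)} := by
    ext x
    simp only [Finset.mem_filter, Finset.mem_univ, true_and, Finset.mem_insert,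
      Finset.mem_singleton]
    constructor
    · rintro ⟨hx, hj⟩
      exact (JL_eq_iff h2 h0 h1 hx.1 hx.2.1).1 hj
    · intro hx
      have gx : Good x := by
        rcases hx with rfl | rfl | rfl | rfl | rfl | rfl <;> assumption
      exact ⟨gx, (JL_eq_iff h2 h0 h1 gx.1 gx.2.1).2 hx⟩
  rw [this]
  have n1 : l + 1 ≠ 0 := fun h => hm (by linear_combination h)
  have n2 : l - 2 ≠ 0 := fun h => h22 (by linear_combination h)
  have n3 : 2 * l - 1 ≠ 0 := fun h => hh (by linear_combination h)
  rw [Finset.card_insert_of_notMem, Finset.card_insert_of_notMem, Finset.card_insert_of_notMem,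
    Finset.card_insert_of_notMem, Finset.card_insert_of_notMem, Finset.card_singleton]
  all_goals
    simp only [Finset.mem_insert, Finset.mem_singleton, not_or]
    repeat' apply And.intro
  all_goals
    intro hE
    first
    | rw [div_eq_div_iff (by assumption) (by assumption)] at hE
    | rw [eq_div_iff (by assumption)] at hE
    | rw [div_eq_iff (by assumption)] at hE
    | skip
    first
    | exact hq (by linear_combination hE)
    | exact hq (by linear_combination -hE)
    | exact n3 (by linear_combination hE)
    | exact n3 (by linear_combination -hE)
    | exact mul_ne_zero a2 n1 (by linear_combination hE)
    | exact mul_ne_zero a2 n1 (by linear_combination -hE)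
    | exact mul_ne_zero h0 n2 (by linear_combination hE)
    | exact mul_ne_zero h0 n2 (by linear_combination -hE)
    | exact n1 (by linear_combination hE)
    | exact n1 (by linear_combination -hE)
    | exact n2 (by linear_combination hE)
    | exact n2 (by linear_combination -hE)
    | exact mul_ne_zero a2 n3 (by linear_combination hE)
    | exact mul_ne_zero a2 n3 (by linear_combination -hE)
    | exact mul_ne_zero h0 n3 (by linear_combination hE)
    | exact mul_ne_zero h0 n3 (by linear_combination -hE)

lemma root_card_two [Fintype F] [DecidableEq F] (h3 : (3 : F) ≠ 0)
    (hc : Fintype.card F % 3 = 1) :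
    (Finset.univ.filter (fun x : F => x ^ 2 - x + 1 = 0)).card = 2 := by
  haveI : Fact (Nat.Prime 3) := ⟨Nat.prime_three⟩
  obtain ⟨w, hw⟩ := exists_prime_orderOf_dvd_card (G := Fˣ) 3
    (by rw [Fintype.card_units]; omega)
  have hw3 : (w : F) ^ 3 = 1 := by
    have := pow_orderOf_eq_one w
    rw [hw] at this
    rw [← Units.val_pow_eq_pow_val, this, Units.val_one]
  have hw1 : (w : F) ≠ 1 := by
    intro h
    have : w = 1 := Units.ext h
    rw [this, orderOf_one] at hw
    omega
  generalize (w : F) = z at hw3 hw1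
  have hz : z ^ 2 + z + 1 = 0 := by
    have : (z - 1) * (z ^ 2 + z + 1) = 0 := by linear_combination hw3
    exact (mul_eq_zero.1 this).resolve_left (sub_ne_zero.2 hw1)
  have : Finset.univ.filter (fun x : F => x ^ 2 - x + 1 = 0) = {-z, 1 + z} := by
    ext x
    simp only [Finset.mem_filter, Finset.mem_univ, true_and, Finset.mem_insert,
      Finset.mem_singleton]
    constructor
    · intro hx
      have : (x - -z) * (x - (1 + z)) = 0 := by linear_combination hx - hz
      simpa only [mul_eq_zero, sub_eq_zero] using this
    · rintro (rfl | rfl) <;> linear_combination hz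
  rw [this, Finset.card_pair]
  intro h
  apply h3
  linear_combination 4 * hz - (-2 * z - 1) * h

lemma root_card_zero [Fintype F] [DecidableEq F] (h3 : (3 : F) ≠ 0)
    (hc : Fintype.card F % 3 = 2) :
    (Finset.univ.filter (fun x : F => x ^ 2 - x + 1 = 0)).card = 0 := by
  haveI : Fact (Nat.Prime 3) := ⟨Nat.prime_three⟩
  rw [Finset.card_eq_zero, Finset.filter_eq_empty_iff]
  intro x _ hx
  have h3' : (-x) ^ 3 = 1 := by linear_combination (-x - 1) * hx
  have hne : -x ≠ 1 := by
    intro h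
    apply h3
    linear_combination hx + (x - 2) * h
  have h0 : -x ≠ 0 := by
    intro h
    rw [h] at h3'
    norm_num at h3'
  have ho : orderOf (Units.mk0 (-x) h0) = 3 := by
    apply orderOf_eq_prime
    · ext; simpa using h3'
    · intro h; exact hne (by simpa using congrArg Units.val h)
  have := orderOf_dvd_card (x := Units.mk0 (-x) h0)
  rw [ho, Fintype.card_units] at this
  omega

lemma good_card [Fintype F] [DecidableEq F] [DecidablePred (Good (F := F))]
    (h2 : (2 : F) ≠ 0) (h3 : (3 : F) ≠ 0) :
    (Finset.univ.filter (Good (F := F))).card +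
      (5 + (Finset.univ.filter (fun x : F => x ^ 2 - x + 1 = 0)).card) = Fintype.card F := by
  have e : Finset.univ.filter (fun x : F => ¬ Good x) =
      ({0, 1, -1, 2, 1 / 2} : Finset F) ∪
        Finset.univ.filter (fun x : F => x ^ 2 - x + 1 = 0) := by
    ext x
    simp only [Finset.mem_filter, Finset.mem_univ, true_and, Finset.mem_insert,
      Finset.mem_singleton, Finset.mem_union, eq_div_iff h2, mul_comm x 2]
    unfold Good
    tauto
  have c5 : ({0, 1, -1, 2, 1 / 2} : Finset F).card = 5 := by
    rw [Finset.card_insert_of_notMem, Finset.card_insert_of_notMem, Finset.card_insert_of_notMem,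
      Finset.card_insert_of_notMem, Finset.card_singleton]
    all_goals
      simp only [Finset.mem_insert, Finset.mem_singleton, not_or, eq_div_iff h2]
      repeat' apply And.intro
    all_goals
      intro hE
      first
      | exact one_ne_zero (α := F) (by linear_combination hE)
      | exact one_ne_zero (α := F) (by linear_combination -hE)
      | exact h2 (by linear_combination hE)
      | exact h2 (by linear_combination -hE)
      | exact h3 (by linear_combination hE)
      | exact h3 (by linear_combination -hE)
  have d : Disjoint ({0, 1, -1, 2, 1 / 2} : Finset F)
      (Finset.univ.filter (fun x : F => x ^ 2 - x + 1 = 0)) := by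
    rw [Finset.disjoint_left]
    intro x hx hq
    simp only [Finset.mem_filter, Finset.mem_univ, true_and] at hq
    simp only [Finset.mem_insert, Finset.mem_singleton, eq_div_iff h2] at hx
    rcases hx with hx | hx | hx | hx | hx
    · exact one_ne_zero (α := F) (by linear_combination hq - (x - 1) * hx)
    · exact one_ne_zero (α := F) (by linear_combination hq - x * hx)
    · exact h3 (by linear_combination hq - (x - 2) * hx)
    · exact h3 (by linear_combination hq - (x + 1) * hx)
    · exact h3 (by linear_combination 4 * hq - (2 * x - 1) * hx)
  rw [← c5, ← Finset.card_union_of_disjoint d, ← e, Finset.card_filter_add_card_filter_not,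
    Finset.card_univ]

lemma set_eq (h2 : (2 : F) ≠ 0) :
    {j : F | ∃ a b : F, (∃ d : F, d ≠ 0 ∧ b = d ^ 2) ∧
        b * (a ^ 2 - 4 * b) ≠ 0 ∧
        a ^ 2 + 12 * b ≠ 0 ∧ a * (a ^ 2 - 36 * b) ≠ 0 ∧
        j = 16 * (a ^ 2 + 12 * b) ^ 3 / (b * (a ^ 2 - 4 * b) ^ 2)} = JL '' {l : F | Good l} := by
  have h4 : (4 : F) ≠ 0 := by
    have : (4 : F) = 2 ^ 2 := by norm_num
    rw [this]; exact pow_ne_zero _ h2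
  have h16 : (16 : F) ≠ 0 := by
    have : (16 : F) = 2 ^ 4 := by norm_num
    rw [this]; exact pow_ne_zero _ h2
  have conv : ∀ l d : F, d ≠ 0 → l ≠ 0 → l ≠ 1 → JL l =
      16 * (((4 * l - 2) * d) ^ 2 + 12 * d ^ 2) ^ 3 /
        (d ^ 2 * (((4 * l - 2) * d) ^ 2 - 4 * d ^ 2) ^ 2) := by
    intro l d hd h0 h1
    have a1 : 1 - l ≠ 0 := sub_ne_zero.2 (Ne.symm h1)
    have e : ((4 * l - 2) * d) ^ 2 - 4 * d ^ 2 = -(16 * (l * (1 - l)) * d ^ 2) := by ring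
    have hne : ((4 * l - 2) * d) ^ 2 - 4 * d ^ 2 ≠ 0 := by
      rw [e]
      exact neg_ne_zero.2 (mul_ne_zero (mul_ne_zero h16 (mul_ne_zero h0 a1)) (pow_ne_zero _ hd))
    unfold JL
    rw [div_eq_div_iff (mul_ne_zero (pow_ne_zero _ h0) (pow_ne_zero _ a1))
      (mul_ne_zero (pow_ne_zero _ hd) (pow_ne_zero _ hne))]
    ring
  ext j
  constructor
  · rintro ⟨a, b, ⟨d, hd, rfl⟩, hA, hB, hC, rfl⟩
    obtain ⟨l, rfl⟩ : ∃ l, a = (4 * l - 2) * d := ⟨(a / d + 2) / 4, by field_simp; ring⟩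
    have g : Good l := by
      refine ⟨?_, ?_, ?_, ?_, ?_, ?_⟩
      · rintro rfl; apply hA; ring
      · rintro rfl; apply hA; ring
      · rintro rfl; apply hC; ring
      · rintro rfl; apply hC; ring
      · intro h; apply hC
        have : 4 * l - 2 = 0 := by linear_combination 2 * h
        rw [this]; ring
      · intro h; apply hB; linear_combination 16 * d ^ 2 * h
    exact ⟨l, g, conv l d hd g.1 g.2.1⟩
  · rintro ⟨l, g, rfl⟩
    have c := conv l 1 one_ne_zero g.1 g.2.1
    obtain ⟨h0, h1, hm, h22, hh, hq⟩ := g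
    have a1 : l - 1 ≠ 0 := sub_ne_zero.2 h1
    have n1 : l + 1 ≠ 0 := fun h => hm (by linear_combination h)
    have n2 : l - 2 ≠ 0 := fun h => h22 (by linear_combination h)
    have n3 : 2 * l - 1 ≠ 0 := fun h => hh (by linear_combination h)
    refine ⟨(4 * l - 2) * 1, 1 ^ 2, ⟨1, one_ne_zero, rfl⟩, ?_, ?_, ?_, c⟩
    · intro h; exact mul_ne_zero h16 (mul_ne_zero h0 a1) (by linear_combination h)
    · intro h; exact mul_ne_zero h16 hq (by linear_combination h)
    · intro h
      exact mul_ne_zero (mul_ne_zero h2 h16) (mul_ne_zero n3 (mul_ne_zero n1 n2))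
        (by linear_combination h)

lemma count_six [Fintype F] [DecidableEq F] [DecidablePred (Good (F := F))]
    (h2 : (2 : F) ≠ 0) :
    (Finset.univ.filter (Good (F := F))).card = 6 * (JL '' {l : F | Good l}).ncard := by
  have e : JL '' {l : F | Good l} = ((Finset.univ.filter (Good (F := F))).image JL : Finset F) := by
    simp
  rw [e, Set.ncard_coe_finset, Finset.card_eq_sum_card_image JL, mul_comm]
  apply Finset.sum_const_nat
  intro j hj
  obtain ⟨l, hl, rfl⟩ := Finset.mem_image.1 hj
  exact fiber_card h2 (Finset.mem_filter.1 hl).2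

end helpers

/-- The number of distinct j-invariants of general Jacobi quartic curves
`E_{a,b}` with `b` a nonzero square and `j ∉ {0, 1728}`. -/
theorem count_j_b_square {F : Type*} [Field F] [Fintype F] (q : ℕ)
    (hq : Fintype.card F = q) (hchar : 3 < ringChar F) :
    (q % 12 = 1 ∨ q % 12 = 7 →
      {j : F | ∃ a b : F, (∃ d : F, d ≠ 0 ∧ b = d ^ 2) ∧
        b * (a ^ 2 - 4 * b) ≠ 0 ∧
        a ^ 2 + 12 * b ≠ 0 ∧ a * (a ^ 2 - 36 * b) ≠ 0 ∧
        j = 16 * (a ^ 2 + 12 * b) ^ 3 / (b * (a ^ 2 - 4 * b) ^ 2)}.ncard =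
        (q - 7) / 6) ∧
    (q % 12 = 5 ∨ q % 12 = 11 →
      {j : F | ∃ a b : F, (∃ d : F, d ≠ 0 ∧ b = d ^ 2) ∧
        b * (a ^ 2 - 4 * b) ≠ 0 ∧
        a ^ 2 + 12 * b ≠ 0 ∧ a * (a ^ 2 - 36 * b) ≠ 0 ∧
        j = 16 * (a ^ 2 + 12 * b) ^ 3 / (b * (a ^ 2 - 4 * b) ^ 2)}.ncard =
        (q - 5) / 6) := by
  classical
  obtain ⟨h2, h3⟩ := two_three hchar
  rw [set_eq h2]
  have c := good_card h2 h3
  rw [count_six h2, hq] at c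
  constructor
  · intro h
    rw [root_card_two h3 (by omega)] at c
    omega
  · intro h
    rw [root_card_zero h3 (by omega)] at c
    omega
end

section
/- Let F_q be a finite field with q elements of characteristic greater than 3, and let N_{a,b} denote the number of distinct values of 16·(a² + 12b)³/(b·(a² − 4b)²) as (a, b) ranges over all pairs in F_q × F_q with b·(a² − 4b) ≠ 0. Then N_{a,b} = (4q + 2)/6 if q ≡ 1 or 7 (mod 12), and N_{a,b} = (4q − 2)/6 if q ≡ 5 or 11 (mod 12). -/
section JQ
variable {F : Type*} [Field F]

theorem jq_key {w v : F} (hw : w ≠ 0) (hv : v ≠ 0) (hne : w ≠ v)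
    (h : (w + 1) ^ 3 / w ^ 2 = (v + 1) ^ 3 / v ^ 2) :
    w ^ 2 * v ^ 2 - 3 * (w * v) - w - v = 0 := by
  rw [div_eq_div_iff (pow_ne_zero _ hw) (pow_ne_zero _ hv)] at h
  have h2 : w - v ≠ 0 := sub_ne_zero.2 hne
  apply mul_left_cancel₀ h2
  linear_combination h

theorem jq_sq {w v : F} (hw : w ≠ 0) (hv : v ≠ 0) (hne : w ≠ v)
    (h : (w + 1) ^ 3 / w ^ 2 = (v + 1) ^ 3 / v ^ 2) :
    w ≠ -1 ∧ ∃ r, 4 * w + 1 = r ^ 2 := by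
  have k := jq_key hw hv hne h
  have h1 : w ≠ -1 := by
    rintro rfl
    have : (v + 1) ^ 2 = 0 := by linear_combination k
    have := pow_eq_zero_iff (two_ne_zero) |>.1 this
    exact hne (by linear_combination -this)
  refine ⟨h1, (2 * w ^ 2 * v - (3 * w + 1)) / (w + 1), ?_⟩
  have h2 : w + 1 ≠ 0 := fun h => h1 (by linear_combination h)
  rw [div_pow, eq_div_iff (pow_ne_zero _ h2)]
  linear_combination -4 * w ^ 2 * k

variable [Fintype F] [DecidableEq F]

open Classical in
theorem jq_sqrt_neg_three (h2 : (2 : F) ≠ 0) (h3 : (3 : F) ≠ 0) :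
    (∃ r : F, r ^ 2 = -3) ↔ 3 ∣ Fintype.card F - 1 := by
  rw [← Fintype.card_units]
  constructor
  · rintro ⟨r, hr⟩
    have h1 : ((r - 1) / 2) ^ 3 = 1 := by
      field_simp
      linear_combination (r - 3) * hr
    have h0 : ((r - 1) / 2) ≠ 0 := by
      intro h; rw [h] at h1; simp at h1
    have hn1 : ((r - 1) / 2) ≠ 1 := by
      intro h
      have : r = 3 := by
        field_simp at h
        linear_combination h
      subst this
      have : (2 : F) * 2 * 3 = 0 := by linear_combination hr
      simp [h2, h3] at this
    have : orderOf (Units.mk0 _ h0) = 3 := by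
      haveI : Fact (Nat.Prime 3) := ⟨Nat.prime_three⟩
      apply orderOf_eq_prime
      · ext; simpa using h1
      · intro h; apply hn1
        have := congrArg Units.val h
        simpa using this
    rw [← this]
    exact orderOf_dvd_card
  · intro h
    haveI : Fact (Nat.Prime 3) := ⟨Nat.prime_three⟩
    obtain ⟨x, hx⟩ := exists_prime_orderOf_dvd_card 3 h
    refine ⟨2 * x + 1, ?_⟩
    have hx3 : (x : F) ^ 3 = 1 := by
      have := pow_orderOf_eq_one x
      rw [hx] at this
      simpa using congrArg Units.val this
    have hx1 : (x : F) - 1 ≠ 0 := by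
      intro h
      have : x = 1 := by ext; simpa using sub_eq_zero.1 h
      subst this; simp at hx
    have : (x : F) ^ 2 + x + 1 = 0 := by
      apply mul_left_cancel₀ hx1
      linear_combination hx3
    linear_combination 4 * this

/-- admissible parameters -/
def jqR (F : Type*) [Field F] [Fintype F] [DecidableEq F] : Finset F :=
  Finset.univ.filter fun r => (r ≠ 0 ∧ r ≠ 1 ∧ r ≠ -1 ∧ r ≠ 3 ∧ r ≠ -3) ∧ r ^ 2 ≠ -3

/-- the points with three-element fibres -/
def jqT (F : Type*) [Field F] [Fintype F] [DecidableEq F] : Finset F :=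
  (jqR F).image fun r => (r ^ 2 - 1) / 4

theorem jq_card_c (h2 : (2 : F) ≠ 0) (h3 : (3 : F) ≠ 0) :
    (Finset.univ.filter fun r : F => r ^ 2 = -3).card =
      if 3 ∣ Fintype.card F - 1 then 2 else 0 := by
  split_ifs with h
  · obtain ⟨r, hr⟩ := (jq_sqrt_neg_three h2 h3).2 h
    rw [Finset.card_eq_two]
    refine ⟨r, -r, ?_, ?_⟩
    · intro h
      have : 2 * r = 0 := by linear_combination h
      have : r = 0 := by simpa [h2] using this
      subst this
      apply h3; linear_combination hr
    · ext s
      simp only [Finset.mem_filter, Finset.mem_univ, true_and, Finset.mem_insert,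
        Finset.mem_singleton]
      rw [← hr, sq_eq_sq_iff_eq_or_eq_neg]
  · rw [Finset.card_eq_zero, Finset.filter_eq_empty_iff]
    intro r _ hr
    exact h ((jq_sqrt_neg_three h2 h3).1 ⟨r, hr⟩)

theorem jq_card_R (h2 : (2 : F) ≠ 0) (h3 : (3 : F) ≠ 0) :
    (jqR F).card + (if 3 ∣ Fintype.card F - 1 then 2 else 0) + 5 = Fintype.card F := by
  rw [← jq_card_c h2 h3]
  have h5 : ({0, 1, -1, 3, -3} : Finset F).card = 5 := by
    have e4 : (4 : F) ≠ 0 := by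
      have : (4 : F) = 2 * 2 := by norm_num
      rw [this]; exact mul_ne_zero h2 h2
    have a1 : (1 : F) ≠ -1 := fun h => h2 (by linear_combination h)
    have a2 : (1 : F) ≠ 3 := fun h => h2 (by linear_combination -h)
    have a3 : (1 : F) ≠ -3 := fun h => e4 (by linear_combination h)
    have a4 : (-1 : F) ≠ 3 := fun h => e4 (by linear_combination -h)
    have a5 : (-1 : F) ≠ -3 := fun h => h2 (by linear_combination h)
    have a6 : (3 : F) ≠ -3 := fun h => mul_ne_zero h2 h3 (by linear_combination h)
    have b1 : (0 : F) ≠ 3 := h3.symm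
    rw [Finset.card_insert_of_notMem, Finset.card_insert_of_notMem,
      Finset.card_insert_of_notMem, Finset.card_insert_of_notMem, Finset.card_singleton]
    · simpa using a6
    · simp only [Finset.mem_insert, Finset.mem_singleton]; tauto
    · simp only [Finset.mem_insert, Finset.mem_singleton]; tauto
    · simp [h3, h3.symm]
  have hd1 : Disjoint (jqR F) (Finset.univ.filter fun r : F => r ^ 2 = -3) := by
    rw [Finset.disjoint_left]; intro r; simp [jqR]
  have hd2 : Disjoint (jqR F ∪ (Finset.univ.filter fun r : F => r ^ 2 = -3))
      {0, 1, -1, 3, -3} := by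
    have e4 : (4 : F) ≠ 0 := by
      have : (4 : F) = 2 * 2 := by norm_num
      rw [this]; exact mul_ne_zero h2 h2
    rw [Finset.disjoint_right]; intro r hr
    simp only [Finset.mem_insert, Finset.mem_singleton] at hr
    have e12 : (12 : F) ≠ 0 := by
      have : (12 : F) = 4 * 3 := by norm_num
      rw [this]; exact mul_ne_zero e4 h3
    simp only [jqR, Finset.mem_union, Finset.mem_filter, Finset.mem_univ, true_and, not_or]
    refine ⟨by tauto, ?_⟩
    rcases hr with rfl | rfl | rfl | rfl | rfl
    · intro h; exact h3 (by linear_combination h)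
    · intro h; exact e4 (by linear_combination h)
    · intro h; exact e4 (by linear_combination h)
    · intro h; exact e12 (by linear_combination h)
    · intro h; exact e12 (by linear_combination h)
  rw [← h5, ← Finset.card_union_of_disjoint hd1, ← Finset.card_union_of_disjoint hd2,
    ← Finset.card_univ]
  congr 1
  ext r
  simp only [jqR, Finset.mem_union, Finset.mem_filter, Finset.mem_univ, true_and,
    Finset.mem_insert, Finset.mem_singleton, iff_true]
  tauto

theorem jq_card_T (h2 : (2 : F) ≠ 0) : (jqR F).card = 2 * (jqT F).card := by
  have e4 : (4 : F) ≠ 0 := by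
    have : (4 : F) = 2 * 2 := by norm_num
    rw [this]; exact mul_ne_zero h2 h2
  rw [Finset.card_eq_sum_card_image (fun r : F => (r ^ 2 - 1) / 4) (jqR F)]
  change ∑ b ∈ jqT F, _ = _
  rw [Finset.sum_const_nat (m := 2), mul_comm]
  intro x hx
  obtain ⟨r, hr, rfl⟩ := Finset.mem_image.1 hx
  rw [Finset.card_eq_two]
  have hr' := hr
  simp only [jqR, Finset.mem_filter, Finset.mem_univ, true_and] at hr
  refine ⟨r, -r, ?_, ?_⟩
  · intro h
    have : 2 * r = 0 := by linear_combination h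
    exact hr.1.1 (by simpa [h2] using this)
  · ext s
    simp only [Finset.mem_filter, Finset.mem_insert, Finset.mem_singleton]
    rw [div_left_inj' e4, sub_left_inj, sq_eq_sq_iff_eq_or_eq_neg]
    constructor
    · exact fun h => h.2
    · refine fun h => ⟨?_, h⟩
      rcases h with rfl | rfl
      · exact hr'
      · simp only [jqR, Finset.mem_filter, Finset.mem_univ, true_and]
        obtain ⟨⟨h0, h1, h1', h3, h3'⟩, hs⟩ := hr
        refine ⟨⟨by simpa using h0, ?_, ?_, ?_, ?_⟩, by simpa using hs⟩
        · intro h; exact h1' (by linear_combination -h)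
        · intro h; exact h1 (by linear_combination -h)
        · intro h; exact h3' (by linear_combination -h)
        · intro h; exact h3 (by linear_combination -h)

theorem jq_mem_T (h2 : (2 : F) ≠ 0) (w : F) :
    w ∈ jqT F ↔ w ≠ 0 ∧ w ≠ -1 ∧ w ≠ 2 ∧ 4 * w + 1 ≠ 0 ∧ ∃ r, 4 * w + 1 = r ^ 2 := by
  have e4 : (4 : F) ≠ 0 := by
    have : (4 : F) = 2 * 2 := by norm_num
    rw [this]; exact mul_ne_zero h2 h2
  simp only [jqT, jqR, Finset.mem_image, Finset.mem_filter, Finset.mem_univ, true_and]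
  constructor
  · rintro ⟨r, ⟨⟨h0, h1, h1', h3, h3'⟩, hs⟩, hw⟩
    have hw' : 4 * w + 1 = r ^ 2 := by
      rw [← hw]; field_simp; ring
    refine ⟨?_, ?_, ?_, ?_, r, hw'⟩
    · rintro rfl
      have : (r - 1) * (r + 1) = 0 := by linear_combination -hw'
      rcases mul_eq_zero.1 this with h | h
      · exact h1 (by linear_combination h)
      · exact h1' (by linear_combination h)
    · rintro rfl
      exact hs (by linear_combination -hw')
    · rintro rfl
      have : (r - 3) * (r + 3) = 0 := by linear_combination -hw'
      rcases mul_eq_zero.1 this with h | h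
      · exact h3 (by linear_combination h)
      · exact h3' (by linear_combination h)
    · rw [hw']; exact pow_ne_zero _ h0
  · rintro ⟨h0, h1, hh, h4, r, hr⟩
    have inj : ∀ z : F, 4 * w = 4 * z → w = z := fun z h => mul_left_cancel₀ e4 h
    refine ⟨r, ⟨⟨?_, ?_, ?_, ?_, ?_⟩, ?_⟩, ?_⟩
    · rintro rfl; exact h4 (by linear_combination hr)
    · rintro rfl; exact h0 (inj _ (by linear_combination hr))
    · rintro rfl; exact h0 (inj _ (by linear_combination hr))
    · rintro rfl; exact hh (inj _ (by linear_combination hr))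
    · rintro rfl; exact hh (inj _ (by linear_combination hr))
    · intro h; exact h1 (inj _ (by linear_combination hr + h))
    · rw [div_eq_iff e4]; linear_combination -hr

/-- the reduced j-map -/
def jqf (w : F) : F := (w + 1) ^ 3 / w ^ 2

theorem jq_card_fT (h2 : (2 : F) ≠ 0) (h3 : (3 : F) ≠ 0) :
    (jqT F).card = 3 * ((jqT F).image jqf).card := by
  have e4 : (4 : F) ≠ 0 := by
    have : (4 : F) = 2 * 2 := by norm_num
    rw [this]; exact mul_ne_zero h2 h2
  rw [Finset.card_eq_sum_card_image jqf (jqT F), Finset.sum_const_nat (m := 3), mul_comm]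
  intro x hx
  obtain ⟨w, hw, rfl⟩ := Finset.mem_image.1 hx
  have hwT := hw
  obtain ⟨r, hr, hrw⟩ := Finset.mem_image.1 hw
  simp only [jqR, Finset.mem_filter, Finset.mem_univ, true_and] at hr
  obtain ⟨⟨h0, h1, h1', h3, h3'⟩, hs⟩ := hr
  have m1 : r - 1 ≠ 0 := sub_ne_zero.2 h1
  have p1 : r + 1 ≠ 0 := fun h => h1' (by linear_combination h)
  have m3 : r - 3 ≠ 0 := sub_ne_zero.2 h3
  have p3 : r + 3 ≠ 0 := fun h => h3' (by linear_combination h)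
  have s3 : r ^ 2 + 3 ≠ 0 := fun h => hs (by linear_combination h)
  have hw0 : w ≠ 0 := ((jq_mem_T h2 w).1 hw).1
  -- second and third roots
  have mem : ∀ s : F, s ≠ 0 → s - 1 ≠ 0 → s - 3 ≠ 0 → s + 1 ≠ 0 → s + 3 ≠ 0 →
      s ^ 2 + 3 ≠ 0 → 2 * (s + 1) / (s - 1) ^ 2 ∈ jqT F := by
    intro s h0 m1 m3 p1 p3 s3
    rw [jq_mem_T h2]
    refine ⟨by positivity, ?_, ?_, ?_, (s + 3) / (s - 1), ?_⟩
    · intro h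
      rw [div_eq_iff (pow_ne_zero _ m1)] at h
      exact s3 (by linear_combination h)
    · intro h
      rw [div_eq_iff (pow_ne_zero _ m1)] at h
      exact mul_ne_zero (mul_ne_zero h2 h0) m3 (by linear_combination -h)
    · have : 4 * (2 * (s + 1) / (s - 1) ^ 2) + 1 = ((s + 3) / (s - 1)) ^ 2 := by
        field_simp; ring
      rw [this]; exact pow_ne_zero _ (div_ne_zero p3 m1)
    · field_simp; ring
  have val : ∀ s : F, s - 1 ≠ 0 → s + 1 ≠ 0 → w = (s ^ 2 - 1) / 4 →
      jqf (2 * (s + 1) / (s - 1) ^ 2) = jqf w := by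
    intro s m1 p1 hw
    have hq : s ^ 2 - 1 ≠ 0 := by
      have : s ^ 2 - 1 = (s - 1) * (s + 1) := by ring
      rw [this]; exact mul_ne_zero m1 p1
    rw [hw]
    unfold jqf
    have e1 : 2 * (s + 1) / (s - 1) ^ 2 + 1 = (s ^ 2 + 3) / (s - 1) ^ 2 := by
      field_simp; ring
    have e2 : (s ^ 2 - 1) / 4 + 1 = (s ^ 2 + 3) / 4 := by
      field_simp; ring
    rw [e1, e2, div_pow, div_pow, div_pow, div_pow, div_div_div_eq, div_div_div_eq,
      div_eq_div_iff (by positivity) (by positivity)]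
    ring
  rw [Finset.card_eq_three]
  have k2 := mem (-r) (by simpa using h0) (fun h => p1 (by linear_combination -h))
    (fun h => p3 (by linear_combination -h)) (fun h => m1 (by linear_combination -h))
    (fun h => m3 (by linear_combination -h)) (by simpa using s3)
  have v2 := val (-r) (fun h => p1 (by linear_combination -h))
     (fun h => m1 (by linear_combination -h)) (by rw [← hrw]; ring)
  have k1 := mem r h0 m1 m3 p1 p3 s3
  have v1 := val r m1 p1 hrw.symm
  have q1 : -r - 1 ≠ 0 := fun h => p1 (by linear_combination -h)
  refine ⟨w, 2 * (r + 1) / (r - 1) ^ 2, 2 * (-r + 1) / (-r - 1) ^ 2, ?_, ?_, ?_, ?_⟩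
  · rw [← hrw]
    intro h
    rw [div_eq_div_iff e4 (pow_ne_zero _ m1)] at h
    exact mul_ne_zero (mul_ne_zero p1 m3) s3 (by linear_combination h)
  · rw [← hrw]
    intro h
    rw [div_eq_div_iff e4 (pow_ne_zero _ q1)] at h
    exact mul_ne_zero (mul_ne_zero m1 p3) s3 (by linear_combination h)
  · intro h
    rw [div_eq_div_iff (pow_ne_zero _ m1) (pow_ne_zero _ q1)] at h
    exact mul_ne_zero (mul_ne_zero (mul_ne_zero h2 h2) h0) s3 (by linear_combination h)
  · ext v
    simp only [Finset.mem_filter, Finset.mem_insert, Finset.mem_singleton]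
    constructor
    · rintro ⟨hv, hf⟩
      by_cases hwv : w = v
      · exact Or.inl hwv.symm
      right
      have hv0 : v ≠ 0 := ((jq_mem_T h2 v).1 hv).1
      have k := jq_key hw0 hv0 hwv hf.symm
      rw [eq_div_iff (pow_ne_zero _ m1), eq_div_iff (pow_ne_zero _ q1)]
      have hr4 : r ^ 2 = 4 * w + 1 := by rw [← hrw]; field_simp; ring
      have : ((v * (r - 1) ^ 2 - 2 * (r + 1))) * (v * (-r - 1) ^ 2 - 2 * (-r + 1)) = 0 := by
        have e : ((v * (r - 1) ^ 2 - 2 * (r + 1))) * (v * (-r - 1) ^ 2 - 2 * (-r + 1)) =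
          v ^ 2 * (r ^ 2 - 1) ^ 2 - 2 * v * (6 * r ^ 2 + 2) + 4 * (1 - r ^ 2) := by ring
        rw [e, hr4]
        linear_combination 16 * k
      rcases mul_eq_zero.1 this with h | h
      · left; linear_combination h
      · right; linear_combination h
    · rintro (rfl | rfl | rfl)
      · exact ⟨hwT, rfl⟩
      · exact ⟨k1, v1⟩
      · exact ⟨k2, v2⟩

theorem jq_card_f (h2 : (2 : F) ≠ 0) (h3 : (3 : F) ≠ 0) :
    ((Finset.univ.filter fun w : F => w ≠ 0).image jqf).card + (jqT F).card + 2 =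
      ((jqT F).image jqf).card + Fintype.card F := by
  have e4 : (4 : F) ≠ 0 := by
    have : (4 : F) = 2 * 2 := by norm_num
    rw [this]; exact mul_ne_zero h2 h2
  set U : Finset F := Finset.univ.filter fun w : F => (w ≠ 0 ∧ w ≠ 2) ∧ w ∉ jqT F with hU
  have key : ∀ v ∈ U, ∀ w, w ≠ 0 → v ≠ w → jqf v = jqf w → 4 * v + 1 = 0 := by
    intro v hv w hw hne h
    simp only [hU, Finset.mem_filter, Finset.mem_univ, true_and, jq_mem_T h2] at hv
    have := jq_sq hv.1.1 hw hne h
    by_contra hc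
    exact hv.2 ⟨hv.1.1, this.1, hv.1.2, hc, this.2⟩
  have hinj : Set.InjOn jqf (U : Set F) := by
    intro v hv w hw h
    by_contra hne
    have hv0 : v ≠ 0 := by simp [hU] at hv; tauto
    have hw0 : w ≠ 0 := by simp [hU] at hw; tauto
    have a := key v hv w hw0 hne h
    have b := key w hw v hv0 (Ne.symm hne) h.symm
    exact hne (mul_left_cancel₀ e4 (by linear_combination a - b))
  have hdis : Disjoint ((jqT F).image jqf) (U.image jqf) := by
    rw [Finset.disjoint_left]
    intro x hx hx'
    obtain ⟨w, hw, rfl⟩ := Finset.mem_image.1 hx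
    obtain ⟨v, hv, hvw⟩ := Finset.mem_image.1 hx'
    have hvT : v ∉ jqT F := by simp [hU] at hv; tauto
    have hw' := (jq_mem_T h2 w).1 hw
    have hne : v ≠ w := by rintro rfl; exact hvT hw
    have hv0 : v ≠ 0 := by simp [hU] at hv; tauto
    have a := key v hv w hw'.1 hne hvw
    have k := jq_key hv0 hw'.1 hne hvw
    have z : (w - 2) ^ 2 = 0 ∨ 4 * w + 1 = 0 := by
      left
      linear_combination 16 * k + (-4 * v * w ^ 2 + w ^ 2 + 12 * w + 4) * a
    rcases z with z | z
    · exact hw'.2.2.1 (sub_eq_zero.1 (pow_eq_zero_iff two_ne_zero |>.1 z))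
    · exact hw'.2.2.2.1 z
  have himg : (Finset.univ.filter fun w : F => w ≠ 0).image jqf =
      (jqT F).image jqf ∪ U.image jqf := by
    rw [← Finset.image_union]
    apply Finset.Subset.antisymm
    · intro x hx
      obtain ⟨w, hw, rfl⟩ := Finset.mem_image.1 hx
      have hw : w ≠ 0 := by simpa using hw
      by_cases hwT : w ∈ jqT F
      · exact Finset.mem_image_of_mem _ (Finset.mem_union_left _ hwT)
      by_cases hw2 : w = 2
      · subst hw2
        refine Finset.mem_image.2 ⟨-1 / 4, Finset.mem_union_right _ ?_, ?_⟩
        · simp only [hU, Finset.mem_filter, Finset.mem_univ, true_and, jq_mem_T h2]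
          refine ⟨⟨div_ne_zero (by simp) e4, ?_⟩, ?_⟩
          · intro h
            rw [div_eq_iff e4] at h
            exact mul_ne_zero h3 h3 (by linear_combination -h)
          · rintro ⟨-, -, -, h, -⟩
            apply h; field_simp; ring
        · unfold jqf
          have : (-1 / 4 + 1 : F) = 3 / 4 := by field_simp; norm_num
          rw [this]; field_simp; norm_num
      · exact Finset.mem_image_of_mem _ (Finset.mem_union_right _ (by simp [hU, hw, hw2, hwT]))
    · apply Finset.image_subset_image
      intro w hw
      rcases Finset.mem_union.1 hw with h | h
      · simpa using ((jq_mem_T h2 w).1 h).1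
      · simp [hU] at h; simpa using h.1.1
  have hUc : U.card + (jqT F).card + 2 = Fintype.card F := by
    have hd1 : Disjoint U (jqT F) := by
      rw [Finset.disjoint_left]; intro w; simp [hU]
    have hc : ({0, 2} : Finset F).card = 2 := Finset.card_pair h2.symm
    have hd2 : Disjoint (U ∪ jqT F) {0, 2} := by
      rw [Finset.disjoint_right]; intro w hw
      simp only [Finset.mem_insert, Finset.mem_singleton] at hw
      simp only [hU, Finset.mem_union, Finset.mem_filter, Finset.mem_univ, true_and,
        jq_mem_T h2]
      tauto
    conv_lhs => rw [← hc]
    rw [← Finset.card_union_of_disjoint hd1, ← Finset.card_union_of_disjoint hd2,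
      ← Finset.card_univ]
    congr 1
    ext w
    simp only [hU, Finset.mem_union, Finset.mem_filter, Finset.mem_univ, true_and,
      Finset.mem_insert, Finset.mem_singleton, iff_true]
    tauto
  rw [himg, Finset.card_union_of_disjoint hdis, Finset.card_image_of_injOn hinj]
  omega

theorem jq_set (h2 : (2 : F) ≠ 0) :
    {j : F | ∃ a b : F, b * (a ^ 2 - 4 * b) ≠ 0 ∧
        j = 16 * (a ^ 2 + 12 * b) ^ 3 / (b * (a ^ 2 - 4 * b) ^ 2)}.ncard =
      ((Finset.univ.filter fun w : F => w ≠ 0).image jqf).card := by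
  have e16 : (16 : F) ≠ 0 := by
    have : (16 : F) = 2 ^ 4 := by norm_num
    rw [this]; exact pow_ne_zero _ h2
  have e256 : (256 : F) ≠ 0 := by
    have : (256 : F) = 2 ^ 8 := by norm_num
    rw [this]; exact pow_ne_zero _ h2
  rw [← Finset.card_image_of_injective _ (mul_right_injective₀ e256), ← Set.ncard_coe_finset]
  congr 1
  ext j
  simp only [Set.mem_setOf_eq, Finset.coe_image, Set.mem_image, Finset.mem_coe,
    Finset.mem_filter, Finset.mem_univ, true_and, exists_exists_and_eq_and]
  constructor
  · rintro ⟨a, b, h, rfl⟩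
    have hb : b ≠ 0 := left_ne_zero_of_mul h
    have hd : a ^ 2 - 4 * b ≠ 0 := right_ne_zero_of_mul h
    refine ⟨(a ^ 2 - 4 * b) / (16 * b), by positivity, ?_⟩
    unfold jqf
    have : (a ^ 2 - 4 * b) / (16 * b) + 1 = (a ^ 2 + 12 * b) / (16 * b) := by
      field_simp; ring
    rw [this]
    field_simp
    ring
  · rintro ⟨w, hw, rfl⟩
    by_cases hu : 16 * w + 4 = 0
    · refine ⟨0, 1, ?_, ?_⟩
      · intro h
        exact mul_ne_zero e16 hw (by linear_combination hu + h)
      · have e4 : (4 : F) ≠ 0 := by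
          have : (4 : F) = 2 * 2 := by norm_num
          rw [this]; exact mul_ne_zero h2 h2
        have : w = -1 / 4 := by
          rw [eq_div_iff e4]
          apply mul_left_cancel₀ e4
          linear_combination hu
        subst this
        unfold jqf
        have : (-1 / 4 + 1 : F) = 3 / 4 := by field_simp; norm_num
        rw [this]; field_simp; norm_num
        try field_simp
        try norm_num
    · refine ⟨16 * w + 4, 16 * w + 4, ?_, ?_⟩
      · have : (16 * w + 4) * ((16 * w + 4) ^ 2 - 4 * (16 * w + 4)) =
          (16 * w + 4) ^ 2 * (16 * w) := by ring
        rw [this]; positivity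
      · have e1 : (16 * w + 4) ^ 2 - 4 * (16 * w + 4) = (16 * w + 4) * (16 * w) := by ring
        have e2 : (16 * w + 4) ^ 2 + 12 * (16 * w + 4) = (16 * w + 4) * (16 * (w + 1)) := by ring
        rw [e1, e2]
        unfold jqf
        generalize 16 * w + 4 = u at *
        field_simp
        try ring

end JQ


/-- The number of distinct j-invariants of general Jacobi quartic curves
`E_{a,b} : y² = x⁴ + a x² + b`, `b (a² − 4b) ≠ 0`, over `F_q`. -/
theorem general_jacobi_quartic_count {F : Type*} [Field F] [Fintype F] (q : ℕ)
    (hq : Fintype.card F = q) (hchar : 3 < ringChar F) :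
    (q % 12 = 1 ∨ q % 12 = 7 →
      {j : F | ∃ a b : F, b * (a ^ 2 - 4 * b) ≠ 0 ∧
        j = 16 * (a ^ 2 + 12 * b) ^ 3 / (b * (a ^ 2 - 4 * b) ^ 2)}.ncard =
        (4 * q + 2) / 6) ∧
    (q % 12 = 5 ∨ q % 12 = 11 →
      {j : F | ∃ a b : F, b * (a ^ 2 - 4 * b) ≠ 0 ∧
        j = 16 * (a ^ 2 + 12 * b) ^ 3 / (b * (a ^ 2 - 4 * b) ^ 2)}.ncard =
        (4 * q - 2) / 6) := by
  classical
  have h2 : (2 : F) ≠ 0 := by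
    intro h
    have : ringChar F ∣ 2 := (ringChar.spec F 2).1 (by exact_mod_cast h)
    have := Nat.le_of_dvd (by norm_num) this
    omega
  have h3 : (3 : F) ≠ 0 := by
    intro h
    have : ringChar F ∣ 3 := (ringChar.spec F 3).1 (by exact_mod_cast h)
    have := Nat.le_of_dvd (by norm_num) this
    omega
  rw [jq_set h2]
  have c1 := jq_card_f h2 h3
  have c2 := jq_card_fT h2 h3
  have c3 := jq_card_T h2
  have c4 := jq_card_R h2 h3
  rw [hq] at c1 c4
  constructor
  · intro h
    rw [if_pos (by omega)] at c4
    omega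
  · intro h
    rw [if_neg (by omega)] at c4
    omega
end
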